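/- Let X be a random variable with density f belonging to the integrated Pearson family IP(μ; δ, β, γ) with δ ≤ 0, let n ≥ 1, and let g ∈ H^{n,n}(X). Define S_{n,(str)} = Σ_{i=1}^{n} (E[q(X)^i g^{(i)}(X)])²/(i! E[q(X)^i] ∏_{j=i−1}^{2i−2}(1−jδ)) + (E[q(X)^n (g^{(n)}(X))²] − (E[q(X)^n g^{(n)}(X)])²/E[q(X)^n]) / ((n+1)! ∏_{j=n}^{2n−1}(1−jδ)). Then S_{n,1}(g) ≤ S_{n,(str)}, with equality if and only if n = 1 or g coincides on the support (α, ω) of X with a polynomial of degree at most n+1. -/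

import Mathlib

open MeasureTheory ProbabilityTheory Finset Filter

noncomputable section

/-- Falling factorial `(x)_k = x (x-1) ⋯ (x-k+1)`, with `(x)_0 = 1`. -/
def fall (x : ℝ) (k : ℕ) : ℝ := ∏ j ∈ Finset.range k, (x - j)

/-- Rising factorial `[x]_k = x (x+1) ⋯ (x+k-1)`, with `[x]_0 = 1`. -/
def rise (x : ℝ) (k : ℕ) : ℝ := ∏ j ∈ Finset.range k, (x + j)

/-- The product `∏_{j=a}^{a+len-1} (1 - j δ)` of `len` consecutive factors
(an empty product is `1`). -/
def pp (δ a : ℝ) (len : ℕ) : ℝ := ∏ j ∈ Finset.range len, (1 - (a + j) * δ)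

/-- The open real interval with (possibly infinite) endpoints `α ω : EReal`. -/
def erealIoo (α ω : EReal) : Set ℝ := {x : ℝ | α < (x : EReal) ∧ (x : EReal) < ω}

/-- `g` coincides on `J` with a polynomial of degree at most `d`. -/
def IsPolyOn (g : ℝ → ℝ) (J : Set ℝ) (d : ℕ) : Prop :=
  ∃ p : Polynomial ℝ, p.natDegree ≤ d ∧ ∀ x ∈ J, g x = p.eval x

/-- The quadratic `q(x) = δ x² + β x + γ` of a Pearson family. -/
def pq (δ β γ : ℝ) : ℝ → ℝ := fun x => δ * x ^ 2 + β * x + γ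

/-- `P` is the distribution of a random variable with density `f` (w.r.t. Lebesgue
measure) belonging to the integrated Pearson family `IP(μ; δ, β, γ)`:
`μ` is the (finite) mean of `P`, `|δ|+|β|+|γ| > 0`, and
`∫_{-∞}^x (μ - t) f(t) dt = q(x) f(x)` for all `x`. -/
def IsIntegratedPearson (P : Measure ℝ) (f : ℝ → ℝ) (μ δ β γ : ℝ) : Prop :=
  IsProbabilityMeasure P ∧
  (∀ x, 0 ≤ f x) ∧
  P = volume.withDensity (fun x => ENNReal.ofReal (f x)) ∧
  Integrable (fun x : ℝ => x) P ∧
  μ = ∫ x, x ∂P ∧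
  0 < |δ| + |β| + |γ| ∧
  ∀ x : ℝ, (∫ t in Set.Iic x, (μ - t) * f t) = pq δ β γ x * f x

/-- Membership in the class `H^{m,n}(X)` for the distribution `P` of `X` with Pearson
quadratic `q` and support `J`.  Here `gd k` plays the role of the `k`-th derivative
`g^{(k)}` of `g = gd 0` on `J`.  With `ℓ = max m n`:  `g ∈ C^{ℓ-1}(J)`
(encoded by `gd k` having derivative `gd (k+1)` at every point of `J` for `k+1 < ℓ`,
and `gd (ℓ-1)` continuous on `J`), `g^{(ℓ-1)}` is absolutely continuous on `J` with
a.e. derivative `g^{(ℓ)} = gd ℓ` (encoded by the fundamental theorem of calculus: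
`gd ℓ` is locally integrable and `gd (ℓ-1)` is its integral on every subinterval of `J`),
and the moment conditions `E[q(X)^n (g^{(n)}(X))²] < ∞` and
`E[q(X)^i |g^{(i)}(X)|] < ∞` for `n < i ≤ m` hold. -/
def MemH (P : Measure ℝ) (q : ℝ → ℝ) (J : Set ℝ) (m n : ℕ) (gd : ℕ → ℝ → ℝ) : Prop :=
  (∀ k, k + 1 < max m n → ∀ x ∈ J, HasDerivAt (gd k) (gd (k + 1) x) x) ∧
  (1 ≤ max m n → ContinuousOn (gd (max m n - 1)) J) ∧
  (1 ≤ max m n → ∀ a ∈ J, ∀ b ∈ J,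
    IntervalIntegrable (gd (max m n)) volume a b ∧
      gd (max m n - 1) b - gd (max m n - 1) a = ∫ t in a..b, gd (max m n) t) ∧
  Integrable (fun x => q x ^ n * (gd n x) ^ 2) P ∧
  ∀ i, n < i → i ≤ m → Integrable (fun x => q x ^ i * |gd i x|) P

/-- The variance bound `S_{m,n}(g)` of Theorem 2.1, for a Pearson distribution `P`
with quadratic `q` and parameter `δ`. -/
def Sbound (P : Measure ℝ) (δ : ℝ) (q : ℝ → ℝ) (m n : ℕ) (gd : ℕ → ℝ → ℝ) : ℝ :=
  (∑ i ∈ Finset.Icc 1 m,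
      ((m.choose i : ℝ) * pp δ ((m : ℝ) + i) n /
          (fall ((m : ℝ) + n) i * (∫ x, q x ^ i ∂P) * pp δ ((i : ℝ) - 1) i *
            pp δ (m : ℝ) n)) *
        (∫ x, q x ^ i * gd i x ∂P) ^ 2) +
    ∑ i ∈ Finset.Icc 1 n,
      (-1 : ℝ) ^ (i - 1) *
          ((n.choose i : ℝ) / (fall ((m : ℝ) + n) i * pp δ (m : ℝ) i)) *
        ∫ x, q x ^ i * (gd i x) ^ 2 ∂P

/-- The Chernoff-type upper bound `S_{n,(str)}` of Afendras–Papadatos. -/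
def SstrBound (P : Measure ℝ) (δ : ℝ) (q : ℝ → ℝ) (n : ℕ) (gd : ℕ → ℝ → ℝ) : ℝ :=
  (∑ i ∈ Finset.Icc 1 n,
      (∫ x, q x ^ i * gd i x ∂P) ^ 2 /
        ((i.factorial : ℝ) * (∫ x, q x ^ i ∂P) * pp δ ((i : ℝ) - 1) i)) +
    ((∫ x, q x ^ n * (gd n x) ^ 2 ∂P) -
        (∫ x, q x ^ n * gd n x ∂P) ^ 2 / (∫ x, q x ^ n ∂P)) /
      (((n + 1).factorial : ℝ) * pp δ (n : ℝ) n)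

section
/-- `u` is on `J` an indefinite integral of `u'`. -/
def ACP (J : Set ℝ) (u u' : ℝ → ℝ) : Prop :=
  ∀ a ∈ J, ∀ b ∈ J, IntervalIntegrable u' volume a b ∧ u b - u a = ∫ t in a..b, u' t

def KK (z t x : ℝ) : ℝ := (if t ≤ x then 1 else 0) - (if t ≤ z then 1 else 0)

lemma KK_meas (z : ℝ) : Measurable (fun p : ℝ × ℝ => KK z p.1 p.2) := by
  unfold KK
  apply Measurable.sub
  · exact Measurable.ite (measurableSet_le measurable_fst measurable_snd) measurable_const measurable_const
  · exact Measurable.ite (measurableSet_le measurable_fst measurable_const) measurable_const measurable_const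

lemma KK_meas1 (z x : ℝ) : Measurable (fun t : ℝ => KK z t x) :=
  (KK_meas z).comp (measurable_id.prodMk measurable_const)

lemma KK_meas2 (z t : ℝ) : Measurable (fun x : ℝ => KK z t x) :=
  (KK_meas z).comp (measurable_const.prodMk measurable_id)

lemma KK_eq (z t x : ℝ) : KK z t x =
    (Set.Ioc z x).indicator (fun _ => (1:ℝ)) t - (Set.Ioc x z).indicator (fun _ => (1:ℝ)) t := by
  unfold KK
  simp only [Set.indicator, Set.mem_Ioc]
  split_ifs <;> first | (norm_num; done) | (exfalso; grind)

lemma KK_abs (z t x : ℝ) : |KK z t x| = (Set.uIoc z x).indicator (fun _ => (1:ℝ)) t := by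
  unfold KK
  simp only [Set.indicator, Set.mem_uIoc]
  split_ifs <;> first | (norm_num; done) | (exfalso; grind)

lemma KK_abs_mul (z t x : ℝ) : |KK z t x| * |x - z| = KK z t x * (x - z) := by
  unfold KK
  split_ifs <;> simp <;> grind [abs_of_nonneg, abs_of_nonpos]

lemma uIoc_sub {J : Set ℝ} (oc : J.OrdConnected) {z x : ℝ} (hz : z ∈ J) (hx : x ∈ J) :
    Set.uIoc z x ⊆ J := Set.uIoc_subset_uIcc.trans (oc.uIcc_subset hz hx)

lemma KK_int {J : Set ℝ} (oc : J.OrdConnected) {u u' : ℝ → ℝ} (h : ACP J u u') {z x : ℝ}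
    (hz : z ∈ J) (hx : x ∈ J) : ∫ t in J, KK z t x * u' t = u x - u z := by
  have mJ : MeasurableSet J := oc.measurableSet
  obtain ⟨hi, he⟩ := h z hz x hx
  rw [he, intervalIntegral]
  have h1 : ∀ t, KK z t x * u' t = (Set.Ioc z x).indicator u' t - (Set.Ioc x z).indicator u' t := by
    intro t
    rw [KK_eq, sub_mul]
    simp [Set.indicator]
  simp_rw [h1]
  have s1 : Set.Ioc z x ⊆ J := fun t ht => uIoc_sub oc hz hx (Set.Ioc_subset_uIoc ht)
  have s2 : Set.Ioc x z ⊆ J := fun t ht => uIoc_sub oc hz hx (Set.Ioc_subset_uIoc' ht)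
  rw [integral_sub, setIntegral_indicator measurableSet_Ioc, setIntegral_indicator measurableSet_Ioc,
    Set.inter_eq_right.2 s1, Set.inter_eq_right.2 s2]
  · exact ((integrable_indicator_iff measurableSet_Ioc).2 hi.1).integrableOn
  · exact ((integrable_indicator_iff measurableSet_Ioc).2 hi.2).integrableOn

lemma ACP.aesm {J : Set ℝ} (op : IsOpen J) {u u' : ℝ → ℝ} (h : ACP J u u') :
    AEStronglyMeasurable u' (volume.restrict J) := by
  apply LocallyIntegrableOn.aestronglyMeasurable
  intro x hx
  obtain ⟨a, b, hab, hs⟩ := mem_nhds_iff_exists_Ioo_subset.1 (op.mem_nhds hx)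
  obtain ⟨a', ha⟩ := exists_between hab.1
  obtain ⟨b', hb⟩ := exists_between hab.2
  have := (h a' (hs ⟨ha.1, by linarith [hab.2]⟩) b' (hs ⟨by linarith [hab.1], hb.2⟩)).1.1
  exact ⟨_, mem_nhdsWithin_of_mem_nhds (Ioc_mem_nhds ha.2 hb.1), this⟩

lemma ACP.cont {J : Set ℝ} (op : IsOpen J) {u u' : ℝ → ℝ} (h : ACP J u u') :
    ContinuousOn u J := by
  intro x hx
  apply ContinuousAt.continuousWithinAt
  obtain ⟨a, b, hab, hs⟩ := mem_nhds_iff_exists_Ioo_subset.1 (op.mem_nhds hx)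
  obtain ⟨a', ha⟩ := exists_between hab.1
  obtain ⟨b', hb⟩ := exists_between hab.2
  have ha' : a' ∈ J := (hs ⟨ha.1, by linarith [hab.2]⟩)
  have hb' : b' ∈ J := (hs ⟨by linarith [hab.1], hb.2⟩)
  have hi := (h a' ha' b' hb').1
  have hc := intervalIntegral.continuousOn_primitive_interval' hi (Set.left_mem_uIcc)
  have h2 : ContinuousOn u (Set.uIcc a' b') := by
    have : ContinuousOn (fun x => u a' + ∫ t in a'..x, u' t) (Set.uIcc a' b') := by fun_prop
    refine this.congr fun y hy => ?_
    rw [Set.uIcc_of_le (by linarith)] at hy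
    have hyJ : y ∈ J := hs ⟨by linarith [hy.1], by linarith [hy.2]⟩
    show u y = u a' + ∫ t in a'..y, u' t
    rw [← (h a' ha' y hyJ).2]; ring
  refine h2.continuousAt ?_
  rw [Set.uIcc_of_le (by linarith)]
  exact Icc_mem_nhds ha.2 hb.1

/-- Fubini. -/
lemma fub {J : Set ℝ} (oc : J.OrdConnected) {u u' ψ : ℝ → ℝ} (h : ACP J u u') {z : ℝ}
    (hz : z ∈ J) (hψ : IntegrableOn ψ J) (h0 : ∫ x in J, ψ x = 0)
    (hKint : Integrable (fun p : ℝ × ℝ => KK z p.1 p.2 * u' p.1 * ψ p.2)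
      ((volume.restrict J).prod (volume.restrict J))) :
    IntegrableOn (fun x => u x * ψ x) J ∧
    IntegrableOn (fun t => u' t * ∫ x in J ∩ Set.Ici t, ψ x) J ∧
    ∫ x in J, u x * ψ x = ∫ t in J, u' t * ∫ x in J ∩ Set.Ici t, ψ x := by
  have mJ : MeasurableSet J := oc.measurableSet
  have e1 : ∀ t, ∫ x in J, KK z t x * u' t * ψ x = u' t * ∫ x in J ∩ Set.Ici t, ψ x := by
    intro t
    have : ∀ x, KK z t x * u' t * ψ x =
        u' t * ((Set.Ici t).indicator ψ x - (if t ≤ z then 1 else 0) * ψ x) := by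
      intro x
      simp only [KK, Set.indicator, Set.mem_Ici]
      split_ifs <;> ring
    simp_rw [this]
    rw [integral_const_mul, integral_sub, integral_const_mul, h0, mul_zero, sub_zero,
      setIntegral_indicator measurableSet_Ici]
    · exact Integrable.indicator hψ measurableSet_Ici
    · exact Integrable.const_mul hψ _
  have e2 : ∀ x ∈ J, ∫ t in J, KK z t x * u' t * ψ x = (u x - u z) * ψ x := by
    intro x hx
    rw [integral_mul_const, KK_int oc h hz hx]
  have i1 : IntegrableOn (fun x => (u x - u z) * ψ x) J := by
    have := hKint.integral_prod_right
    refine this.congr ?_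
    filter_upwards [ae_restrict_mem mJ] with x hx
    exact e2 x hx
  have i2 : IntegrableOn (fun x => u z * ψ x) J := Integrable.const_mul hψ _
  have e3 : (fun x => u x * ψ x) = fun x => (u x - u z) * ψ x + u z * ψ x := by
    ext x; ring
  refine ⟨?_, ?_, ?_⟩
  · rw [e3]; exact i1.add i2
  · have := hKint.integral_prod_left
    refine this.congr ?_
    filter_upwards with t
    exact e1 t
  · rw [e3, integral_add i1 i2, integral_const_mul, h0, mul_zero, add_zero]
    rw [← setIntegral_congr_fun mJ e2]
    simp_rw [← e1]
    rw [integral_integral_swap]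
    exact hKint.swap

structure PW (J : Set ℝ) (δ β γ : ℝ) (w : ℝ → ℝ) (m s : ℝ) : Prop where
  op : IsOpen J
  oc : J.OrdConnected
  hδ : δ ≤ 0
  hs : 0 < s
  hz : m / s ∈ J
  wc : ContinuousOn w J
  wp : ∀ x ∈ J, 0 < w x
  qp : ∀ x ∈ J, 0 < pq δ β γ x
  i0 : IntegrableOn w J
  i1 : IntegrableOn (fun x => x * w x) J
  tot : ∫ x in J, (s * x - m) * w x = 0
  tail : ∀ t ∈ J, ∫ x in J ∩ Set.Ici t, (s * x - m) * w x = pq δ β γ t * w t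

variable {J : Set ℝ} {δ β γ : ℝ} {w : ℝ → ℝ} {m s : ℝ}

lemma PW.mJ (H : PW J δ β γ w m s) : MeasurableSet J := H.oc.measurableSet

lemma PW.ilin (H : PW J δ β γ w m s) : IntegrableOn (fun x => (s * x - m) * w x) J := by
  have := (H.i1.const_mul s).sub (H.i0.const_mul m)
  refine this.congr ?_
  filter_upwards with x
  simp; ring

lemma PW.waem (H : PW J δ β γ w m s) : AEMeasurable w (volume.restrict J) :=
  H.i0.aestronglyMeasurable.aemeasurable

lemma PW.waem2 (H : PW J δ β γ w m s) : AEMeasurable (fun p : ℝ × ℝ => w p.2)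
    ((volume.restrict J).prod (volume.restrict J)) :=
  H.waem.comp_quasiMeasurePreserving Measure.quasiMeasurePreserving_snd

lemma aem1 {J : Set ℝ} {g : ℝ → ENNReal} (hg : AEMeasurable g (volume.restrict J)) :
    AEMeasurable (fun p : ℝ × ℝ => g p.1)
    ((volume.restrict J).prod (volume.restrict J)) :=
  hg.comp_quasiMeasurePreserving Measure.quasiMeasurePreserving_fst

lemma PW.kint (H : PW J δ β γ w m s) (t : ℝ) (ht : t ∈ J) :
    ∫⁻ x in J, ENNReal.ofReal (|KK (m/s) t x| * |s * x - m| * w x) =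
      ENNReal.ofReal (pq δ β γ t * w t) := by
  have hs := H.hs
  have e0 : ∀ x, |KK (m/s) t x| * |s * x - m| = KK (m/s) t x * (s * x - m) := by
    intro x
    have : s * x - m = s * (x - m / s) := by field_simp
    rw [this, abs_mul, abs_of_pos hs, mul_left_comm, KK_abs_mul]; ring
  have e1 : ∀ x, |KK (m/s) t x| * |s * x - m| * w x = (Set.Ici t).indicator (fun x => (s * x - m) * w x) x
      - (if t ≤ m / s then 1 else 0) * ((s * x - m) * w x) := by
    intro x
    rw [e0]
    simp only [KK, Set.indicator, Set.mem_Ici]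
    split_ifs <;> ring
  have i1 := Integrable.indicator H.ilin (measurableSet_Ici (a := t))
  have i2 := Integrable.const_mul H.ilin (if t ≤ m / s then 1 else 0)
  rw [← ofReal_integral_eq_lintegral_ofReal]
  · congr 1
    simp_rw [e1]
    rw [integral_sub i1 i2, integral_const_mul, H.tot, mul_zero, sub_zero,
      setIntegral_indicator measurableSet_Ici, H.tail t ht]
  · simp_rw [e1]; exact i1.sub i2
  · filter_upwards [ae_restrict_mem H.mJ] with x hx
    have := H.wp x hx
    simp; positivity

/-- Tonelli. -/
lemma PW.ton (H : PW J δ β γ w m s) {g : ℝ → ENNReal} (hg : AEMeasurable g (volume.restrict J)) :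
    ∫⁻ x in J, (∫⁻ t in J, ENNReal.ofReal |KK (m/s) t x| * g t) * ENNReal.ofReal (|s * x - m| * w x) =
      ∫⁻ t in J, g t * ENNReal.ofReal (pq δ β γ t * w t) := by
  have hk : Measurable (fun p : ℝ × ℝ => ENNReal.ofReal |KK (m/s) p.1 p.2|) :=
    ((measurable_norm).comp (KK_meas (m/s))).ennreal_ofReal
  have ml : Measurable (fun x : ℝ => s * x - m) := by fun_prop
  have hl : AEMeasurable (fun p : ℝ × ℝ => ENNReal.ofReal (|s * p.2 - m| * w p.2))
      ((volume.restrict J).prod (volume.restrict J)) := by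
    refine AEMeasurable.ennreal_ofReal (AEMeasurable.mul ?_ H.waem2)
    exact (measurable_norm.comp (ml.comp measurable_snd)).aemeasurable
  have e1 : ∀ x, (∫⁻ t in J, ENNReal.ofReal |KK (m/s) t x| * g t) * ENNReal.ofReal (|s * x - m| * w x)
      = ∫⁻ t in J, ENNReal.ofReal |KK (m/s) t x| * g t * ENNReal.ofReal (|s * x - m| * w x) := by
    intro x
    rw [lintegral_mul_const'']
    exact ((hk.comp (measurable_id.prodMk measurable_const)).aemeasurable).mul hg
  simp_rw [e1]
  rw [← lintegral_lintegral_swap (f := fun t x => ENNReal.ofReal |KK (m/s) t x| * g t * ENNReal.ofReal (|s * x - m| * w x))]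
  swap
  · exact (hk.aemeasurable.mul (aem1 hg)).mul hl
  refine setLIntegral_congr_fun H.mJ fun t ht => ?_
  beta_reduce
  rw [← H.kint t ht, ← lintegral_const_mul'']
  · refine lintegral_congr fun x => ?_
    rw [mul_assoc (|KK (m/s) t x|), ENNReal.ofReal_mul (abs_nonneg (KK (m/s) t x))]; ring
  · refine AEMeasurable.ennreal_ofReal (AEMeasurable.mul ?_ H.waem)
    exact ((measurable_norm.comp (KK_meas2 _ _)).mul (measurable_norm.comp ml)).aemeasurable

end

section
variable {J : Set ℝ} {δ β γ : ℝ} {w : ℝ → ℝ} {m s : ℝ}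

/-- `q` as a polynomial -/
def qP (δ β γ : ℝ) : Polynomial ℝ :=
  Polynomial.C δ * Polynomial.X ^ 2 + Polynomial.C β * Polynomial.X + Polynomial.C γ

lemma qP_eval (x : ℝ) : (qP δ β γ).eval x = pq δ β γ x := by simp [qP, pq]

lemma pq_cont : Continuous (pq δ β γ) := by unfold pq; fun_prop

lemma lint_KK (oc : J.OrdConnected) {z x : ℝ} (hz : z ∈ J) (hx : x ∈ J) (g : ℝ → ENNReal) :
    ∫⁻ t in J, ENNReal.ofReal |KK z t x| * g t = ∫⁻ t in Set.uIoc z x, g t := by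
  have : ∀ t, ENNReal.ofReal |KK z t x| * g t = (Set.uIoc z x).indicator g t := by
    intro t
    rw [KK_abs]
    by_cases h : t ∈ Set.uIoc z x <;> simp [h]
  simp_rw [this]
  rw [setLIntegral_indicator measurableSet_uIoc, Set.inter_eq_left.2 (uIoc_sub oc hz hx)]

lemma lint_pow (z x : ℝ) (j : ℕ) : ∫⁻ t in Set.uIoc z x, ENNReal.ofReal (|t - z| ^ j) =
    ENNReal.ofReal (|x - z| ^ (j+1) / (j+1)) := by
  rw [← ofReal_integral_eq_lintegral_ofReal, integral_pow_abs_sub_uIoc]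
  · have : Continuous (fun t => |t - z| ^ j) := by fun_prop
    have h := (this.intervalIntegrable (μ := volume) z x)
    rwa [intervalIntegrable_iff] at h
  · filter_upwards with t
    simp

lemma PW.momz (H : PW J δ β γ w m s) (j : ℕ) :
    IntegrableOn (fun x => |x - m/s| ^ j * w x) J := by
  have hs := H.hs
  have meas : ∀ j : ℕ, AEStronglyMeasurable (fun x => |x - m/s| ^ j * w x) (volume.restrict J) := by
    intro j
    have : Continuous (fun x => |x - m/s| ^ j) := by fun_prop
    exact this.aestronglyMeasurable.mul H.i0.aestronglyMeasurable
  induction j using Nat.strong_induction_on with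
  | _ j ih =>
  match j with
  | 0 => simpa using H.i0
  | 1 =>
    have := (H.ilin.const_mul (1/s)).norm
    refine this.congr ?_
    filter_upwards [ae_restrict_mem H.mJ] with x hx
    have h1 : s * x - m = s * (x - m / s) := by field_simp
    rw [h1, ← mul_assoc, ← mul_assoc, one_div_mul_cancel hs.ne', one_mul, norm_mul,
      Real.norm_eq_abs, Real.norm_eq_abs, abs_of_pos (H.wp x hx), pow_one]
  | (j+2) =>
    set z := m / s with hz
    have key := H.ton (g := fun t => ENNReal.ofReal (|t - z| ^ j)) (by fun_prop)
    have b1 : ∀ t, pq δ β γ t ≤ |pq δ β γ z| + |2 * δ * z + β| * |t - z| := by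
      intro t
      have e : pq δ β γ t = pq δ β γ z + (2 * δ * z + β) * (t - z) + δ * (t - z)^2 := by
        unfold pq; ring
      have := le_abs_self ((2 * δ * z + β) * (t - z))
      rw [abs_mul] at this
      have := le_abs_self (pq δ β γ z)
      nlinarith [sq_nonneg (t - z), mul_nonneg (neg_nonneg.2 H.hδ) (sq_nonneg (t - z))]
    have hI : IntegrableOn (fun t => |t - z| ^ j * (pq δ β γ t * w t)) J := by
      have g1 := ((ih j (by omega)).const_mul (|pq δ β γ z|)).add
        ((ih (j+1) (by omega)).const_mul (|2 * δ * z + β|))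
      refine Integrable.mono' g1 ?_ ?_
      · have : Continuous (fun x => |x - z| ^ j * pq δ β γ x) := by
          have := pq_cont (δ := δ) (β := β) (γ := γ); fun_prop
        have := this.aestronglyMeasurable (μ := volume.restrict J) |>.mul H.i0.aestronglyMeasurable
        refine this.congr ?_
        filter_upwards with x
        simp [mul_assoc]
      · filter_upwards [ae_restrict_mem H.mJ] with x hx
        have h1 := H.wp x hx
        have h2 := H.qp x hx
        have h3 := b1 x
        rw [Real.norm_of_nonneg (by positivity)]
        have : |x - z| ^ j * (pq δ β γ x * w x) ≤ |x - z| ^ j * ((|pq δ β γ z| + |2 * δ * z + β| * |x - z|) * w x) := by gcongr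
        refine this.trans (le_of_eq ?_)
        simp; ring
    have hf : ∫⁻ t in J, ENNReal.ofReal (|t - z| ^ j) * ENNReal.ofReal (pq δ β γ t * w t) < ⊤ := by
      have : ∀ t, ENNReal.ofReal (|t - z| ^ j) * ENNReal.ofReal (pq δ β γ t * w t) =
        ENNReal.ofReal (|t - z| ^ j * (pq δ β γ t * w t)) := by
        intro t; rw [← ENNReal.ofReal_mul (by positivity)]
      simp_rw [this]
      exact hI.lintegral_lt_top
    rw [← key] at hf
    refine (Integrable.const_mul (c := (j + 1) / s) ?_ : Integrable (fun x => (j + 1) / s * ((|x - z| ^ (j+1) / (j+1)) * (|s * x - m| * w x))) (volume.restrict J)).congr ?_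
    · refine ⟨?_, ?_⟩
      · have := ((meas (j+2)).const_mul (s / (j + 1)))
        refine this.congr ?_
        filter_upwards with x
        have h1 : s * x - m = s * (x - z) := by rw [hz]; field_simp
        rw [h1, abs_mul, abs_of_pos hs]; ring
      · rw [hasFiniteIntegral_iff_enorm]
        refine lt_of_le_of_lt (le_of_eq ?_) hf
        refine setLIntegral_congr_fun H.mJ fun x hx => ?_
        beta_reduce
        have h1 := H.wp x hx
        rw [lint_KK H.oc H.hz hx, lint_pow, ← ENNReal.ofReal_mul (by positivity),
          Real.enorm_of_nonneg (by positivity)]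
    · filter_upwards with x
      have h1 : s * x - m = s * (x - z) := by rw [hz]; field_simp
      have : (j:ℝ) + 1 ≠ 0 := by positivity
      rw [h1, abs_mul, abs_of_pos hs]; field_simp; ring

lemma PW.ipoly (H : PW J δ β γ w m s) (p : Polynomial ℝ) :
    IntegrableOn (fun x => p.eval x * w x) J := by
  have h1 : ∀ k : ℕ, IntegrableOn (fun x => (x - m/s) ^ k * w x) J := by
    intro k
    refine Integrable.mono (H.momz k) ?_ ?_
    · have : Continuous (fun x => (x - m/s) ^ k) := by fun_prop
      exact this.aestronglyMeasurable.mul H.i0.aestronglyMeasurable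
    · filter_upwards with x
      simp [norm_mul]
  have h2 : ∀ x, p.eval x * w x = ∑ i ∈ Finset.range ((p.taylor (m/s)).natDegree + 1),
      (p.taylor (m/s)).coeff i * ((x - m/s) ^ i * w x) := by
    intro x
    rw [← Polynomial.taylor_eval_sub (m/s) p x, Polynomial.eval_eq_sum_range, Finset.sum_mul]
    simp [mul_assoc]
  simp_rw [h2]
  exact integrable_finsetSum _ fun i _ => (h1 i).const_mul _

lemma CS {α : Type*} [MeasurableSpace α] (μ : Measure α) {a b : α → ENNReal} (ha : AEMeasurable a μ)
    (hb : AEMeasurable b μ) : (∫⁻ x, a x * b x ∂μ) ^ 2 ≤ (∫⁻ x, a x ^ 2 ∂μ) * ∫⁻ x, b x ^ 2 ∂μ := by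
  have := ENNReal.lintegral_mul_le_Lp_mul_Lq μ (p := 2) (q := 2) Real.HolderConjugate.two_two ha hb
  simp only [Pi.mul_apply, ENNReal.rpow_ofNat] at this
  refine (pow_le_pow_left' this 2).trans (le_of_eq ?_)
  rw [mul_pow, ← ENNReal.rpow_natCast, ← ENNReal.rpow_natCast, ← ENNReal.rpow_mul, ← ENNReal.rpow_mul]
  norm_num

lemma PW.CSK (H : PW J δ β γ w m s) {g : ℝ → ℝ} (hg : AEMeasurable g (volume.restrict J)) {x : ℝ}
    (hx : x ∈ J) :
    (∫⁻ t in J, ENNReal.ofReal |KK (m/s) t x| * ENNReal.ofReal |g t|) ^ 2 ≤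
    ENNReal.ofReal |x - m/s| * ∫⁻ t in J, ENNReal.ofReal |KK (m/s) t x| * ENNReal.ofReal (g t ^ 2) := by
  rw [lint_KK H.oc H.hz hx, lint_KK H.oc H.hz hx]
  have hg' : AEMeasurable g (volume.restrict (Set.uIoc (m/s) x)) :=
    hg.mono_measure (Measure.restrict_mono (uIoc_sub H.oc H.hz hx) le_rfl)
  have := CS (volume.restrict (Set.uIoc (m/s) x)) (a := fun _ => 1) (b := fun t => ENNReal.ofReal |g t|)
    aemeasurable_const (measurable_norm.comp_aemeasurable hg').ennreal_ofReal
  simp only [one_mul, one_pow] at this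
  refine this.trans (le_of_eq ?_)
  congr 1
  · have := lint_pow (m/s) x 0
    simpa using this
  · refine lintegral_congr fun t => ?_
    rw [← ENNReal.ofReal_pow (abs_nonneg _), sq_abs]

lemma PW.chern (H : PW J δ β γ w m s) {g : ℝ → ℝ} (hg : AEMeasurable g (volume.restrict J))
    (hi : IntegrableOn (fun t => g t ^ 2 * (pq δ β γ t * w t)) J) :
    ∫⁻ x in J, (∫⁻ t in J, ENNReal.ofReal |KK (m/s) t x| * ENNReal.ofReal |g t|) ^ 2
      * ENNReal.ofReal (w x) < ⊤ := by
  have hs := H.hs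
  have key := H.ton (g := fun t => ENNReal.ofReal (g t ^ 2)) ((hg.pow_const 2).ennreal_ofReal)
  have hf : ∫⁻ t in J, ENNReal.ofReal (g t ^ 2) * ENNReal.ofReal (pq δ β γ t * w t) < ⊤ := by
    have : ∀ t, ENNReal.ofReal (g t ^ 2) * ENNReal.ofReal (pq δ β γ t * w t) =
      ENNReal.ofReal (g t ^ 2 * (pq δ β γ t * w t)) := by
      intro t; rw [← ENNReal.ofReal_mul (by positivity)]
    simp_rw [this]
    exact hi.lintegral_lt_top
  rw [← key] at hf
  have : ∫⁻ x in J, (∫⁻ t in J, ENNReal.ofReal |KK (m/s) t x| * ENNReal.ofReal |g t|) ^ 2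
      * ENNReal.ofReal (w x) ≤ ENNReal.ofReal (1/s) * ∫⁻ x in J,
      (∫⁻ t in J, ENNReal.ofReal |KK (m/s) t x| * ENNReal.ofReal (g t ^ 2)) * ENNReal.ofReal (|s * x - m| * w x) := by
    rw [← lintegral_const_mul' _ _ ENNReal.ofReal_ne_top]
    refine setLIntegral_mono' H.mJ fun x hx => ?_
    refine (mul_le_mul_left (H.CSK hg hx) _).trans (le_of_eq ?_)
    have h1 : s * x - m = s * (x - m / s) := by field_simp
    rw [mul_left_comm (ENNReal.ofReal (1/s)), ← ENNReal.ofReal_mul (by positivity), mul_comm (ENNReal.ofReal |x - m/s|), mul_assoc,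
      ← ENNReal.ofReal_mul (by positivity)]
    congr 2
    rw [h1, abs_mul, abs_of_pos hs]; field_simp
  exact this.trans_lt (ENNReal.mul_lt_top ENNReal.ofReal_lt_top hf)

lemma PW.ibp (H : PW J δ β γ w m s) {u u' φ : ℝ → ℝ} (h : ACP J u u')
    (hu : IntegrableOn (fun t => u' t ^ 2 * (pq δ β γ t * w t)) J)
    (hφm : AEStronglyMeasurable φ (volume.restrict J))
    (hφ : IntegrableOn (fun x => φ x ^ 2 * w x) J) (h0 : ∫ x in J, φ x * w x = 0) :
    IntegrableOn (fun x => u x * (φ x * w x)) J ∧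
    IntegrableOn (fun t => u' t * ∫ x in J ∩ Set.Ici t, φ x * w x) J ∧
    ∫ x in J, u x * (φ x * w x) = ∫ t in J, u' t * ∫ x in J ∩ Set.Ici t, φ x * w x := by
  have hum := h.aesm H.op
  have wm := H.i0.aestronglyMeasurable
  have hψ : IntegrableOn (fun x => φ x * w x) J := by
    refine (H.i0.add hφ).mono' (hφm.mul wm) ?_
    filter_upwards [ae_restrict_mem H.mJ] with x hx
    have := H.wp x hx
    rw [norm_mul, Real.norm_of_nonneg this.le, Real.norm_eq_abs]
    simp only [Pi.add_apply]
    have : |φ x| ≤ 1 + φ x ^ 2 := by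
      rw [← sq_abs]; nlinarith [sq_nonneg (|φ x| - 1), abs_nonneg (φ x)]
    nlinarith
  refine fub H.oc h H.hz hψ h0 ⟨?_, ?_⟩
  · refine AEStronglyMeasurable.mul (AEStronglyMeasurable.mul ?_ ?_) ?_
    · exact (KK_meas _).aestronglyMeasurable
    · exact hum.comp_fst
    · exact (hφm.mul wm).comp_snd
  · rw [hasFiniteIntegral_iff_enorm, lintegral_prod_symm]
    swap
    · refine AEMeasurable.enorm ?_
      refine AEMeasurable.mul (AEMeasurable.mul ?_ ?_) ?_
      · exact (KK_meas _).aemeasurable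
      · exact hum.comp_fst.aemeasurable
      · exact (hφm.mul wm).comp_snd.aemeasurable
    have c := H.chern hum.aemeasurable hu
    have c2 : ∫⁻ x in J, ENNReal.ofReal (φ x ^ 2 * w x) < ⊤ := hφ.lintegral_lt_top
    have hle : ∫⁻ x in J, ∫⁻ t in J, ‖KK (m/s) t x * u' t * (φ x * w x)‖ₑ ≤
        ∫⁻ x in J, ((∫⁻ t in J, ENNReal.ofReal |KK (m/s) t x| * ENNReal.ofReal |u' t|) ^ 2
      * ENNReal.ofReal (w x) + ENNReal.ofReal (φ x ^ 2 * w x)) := by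
      refine setLIntegral_mono' H.mJ fun x hx => ?_
      have hw := H.wp x hx
      have e1 : ∀ t, ‖KK (m/s) t x * u' t * (φ x * w x)‖ₑ =
          ENNReal.ofReal |KK (m/s) t x| * ENNReal.ofReal |u' t| * ENNReal.ofReal (|φ x| * w x) := by
        intro t
        rw [← ENNReal.ofReal_mul (by positivity), ← ENNReal.ofReal_mul (by positivity),
          ← ofReal_norm]
        simp [norm_mul, abs_of_pos hw]
      simp_rw [e1]
      rw [lintegral_mul_const' _ _ ENNReal.ofReal_ne_top]
      set U := ∫⁻ t in J, ENNReal.ofReal |KK (m/s) t x| * ENNReal.ofReal |u' t|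
      rw [ENNReal.ofReal_mul (abs_nonneg _), ENNReal.ofReal_mul (sq_nonneg _), ← mul_assoc, ← add_mul,
        ← sq_abs, ENNReal.ofReal_pow (abs_nonneg _)]
      gcongr
      set A := ENNReal.ofReal |φ x|
      rcases le_total U A with hUA | hUA
      · calc U * A ≤ A * A := by gcongr
          _ = A ^ 2 := by ring
          _ ≤ _ := le_add_self
      · calc U * A ≤ U * U := by gcongr
          _ = U ^ 2 := by ring
          _ ≤ _ := le_self_add
    refine hle.trans_lt ?_
    rw [lintegral_add_right']
    · exact ENNReal.add_lt_top.2 ⟨c, c2⟩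
    · exact hφ.aestronglyMeasurable.aemeasurable.ennreal_ofReal

lemma PW.usq (H : PW J δ β γ w m s) {u u' : ℝ → ℝ} (h : ACP J u u')
    (hu : IntegrableOn (fun t => u' t ^ 2 * (pq δ β γ t * w t)) J) :
    IntegrableOn (fun x => u x ^ 2 * w x) J := by
  have hum := h.aesm H.op
  have hc := h.cont H.op
  have wm := H.i0.aestronglyMeasurable
  have um : AEStronglyMeasurable u (volume.restrict J) := hc.aestronglyMeasurable H.mJ
  have c := H.chern hum.aemeasurable hu
  have i1 : IntegrableOn (fun x => (u x - u (m/s)) ^ 2 * w x) J := by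
    refine ⟨((um.sub aestronglyMeasurable_const).pow 2).mul wm, ?_⟩
    rw [hasFiniteIntegral_iff_enorm]
    refine lt_of_le_of_lt ?_ c
    refine setLIntegral_mono' H.mJ fun x hx => ?_
    have hw := H.wp x hx
    rw [Real.enorm_of_nonneg (by positivity), ENNReal.ofReal_mul (by positivity), ← sq_abs,
      ENNReal.ofReal_pow (abs_nonneg _)]
    gcongr
    rw [← KK_int H.oc h H.hz hx, ← Real.norm_eq_abs, ofReal_norm]
    refine (enorm_integral_le_lintegral_enorm _).trans (le_of_eq ?_)
    refine lintegral_congr fun t => ?_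
    rw [← ENNReal.ofReal_mul (by positivity), ← abs_mul, ← Real.norm_eq_abs, ofReal_norm]
  refine ((i1.const_mul 2).add (H.i0.const_mul (2 * u (m/s)^2))).mono' ((um.pow 2).mul wm) ?_
  filter_upwards [ae_restrict_mem H.mJ] with x hx
  have hw := H.wp x hx
  simp only [Pi.mul_apply, Pi.pow_apply, Pi.add_apply]
  rw [Real.norm_of_nonneg (by positivity)]
  have : u x ^ 2 ≤ 2 * (u x - u (m/s))^2 + 2 * u (m/s)^2 := by nlinarith [sq_nonneg (u x - 2 * u (m/s))]
  nlinarith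

end

section
variable {J : Set ℝ} {δ β γ : ℝ} {w : ℝ → ℝ} {m s : ℝ}

/-- the adjoint of the derivative -/
def AA (δ β γ m s : ℝ) (r : Polynomial ℝ) : Polynomial ℝ :=
  (Polynomial.C s * Polynomial.X - Polynomial.C m) * r - qP δ β γ * r.derivative

lemma PW.ipolyq (H : PW J δ β γ w m s) (p : Polynomial ℝ) :
    IntegrableOn (fun x => p.eval x * (pq δ β γ x * w x)) J := by
  have := H.ipoly (p * qP δ β γ)
  simpa [qP_eval, mul_assoc] using this

lemma acp_of_deriv (oc : J.OrdConnected) {u u' : ℝ → ℝ} (h : ∀ x ∈ J, HasDerivAt u (u' x) x)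
    (hc : ContinuousOn u' J) : ACP J u u' := by
  intro a ha b hb
  have hs := oc.uIcc_subset ha hb
  have hi : IntervalIntegrable u' volume a b := (hc.mono hs).intervalIntegrable
  exact ⟨hi, (intervalIntegral.integral_eq_sub_of_hasDerivAt (fun x hx => h x (hs hx)) hi).symm⟩

lemma acp_poly (oc : J.OrdConnected) (r : Polynomial ℝ) :
    ACP J (fun x => r.eval x) (fun x => r.derivative.eval x) :=
  acp_of_deriv oc (fun x _ => r.hasDerivAt x) (Polynomial.continuous _).continuousOn

lemma acp_max (r : Polynomial ℝ) (t : ℝ) :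
    ACP J (fun x => r.eval (max x t)) ((Set.Ici t).indicator fun x => r.derivative.eval x) := by
  intro a _ b _
  have hi : IntervalIntegrable ((Set.Ici t).indicator fun x => r.derivative.eval x) volume a b := by
    have := (r.derivative.continuous).intervalIntegrable (μ := volume) a b
    rw [intervalIntegrable_iff] at this ⊢
    exact Integrable.indicator this measurableSet_Ici
  refine ⟨hi, ?_⟩
  symm
  refine integral_eq_of_hasDerivAt_off_countable (s := {t}) (fun x => r.eval (max x t)) _ (Set.countable_singleton t) ?_ ?_ hi
  · have := r.continuous
    fun_prop
  · rintro x ⟨_, hx⟩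
    rcases lt_or_gt_of_ne (show x ≠ t from hx) with h | h
    · rw [Set.indicator_of_notMem (by simpa using h)]
      refine (hasDerivAt_const x (r.eval t)).congr_of_eventuallyEq ?_
      filter_upwards [Iio_mem_nhds h] with y hy
      rw [max_eq_right (le_of_lt hy)]
    · rw [Set.indicator_of_mem (by simpa using h.le)]
      refine (r.hasDerivAt x).congr_of_eventuallyEq ?_
      filter_upwards [Ioi_mem_nhds h] with y hy
      rw [max_eq_left (le_of_lt hy)]

lemma PW.linsq (H : PW J δ β γ w m s) : IntegrableOn (fun x => (s * x - m) ^ 2 * w x) J := by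
  have := H.ipoly ((Polynomial.C s * Polynomial.X - Polynomial.C m) ^ 2)
  simpa using this

lemma PW.ibplin (H : PW J δ β γ w m s) {u u' : ℝ → ℝ} (h : ACP J u u')
    (hu : IntegrableOn (fun t => u' t ^ 2 * (pq δ β γ t * w t)) J) :
    ∫ x in J, u x * ((s * x - m) * w x) = ∫ t in J, u' t * (pq δ β γ t * w t) := by
  have := (H.ibp h hu (φ := fun x => s * x - m)
    (by fun_prop) H.linsq H.tot).2.2
  rw [this]
  refine setIntegral_congr_fun H.mJ fun t ht => ?_
  beta_reduce
  rw [H.tail t ht]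

lemma PW.totA (H : PW J δ β γ w m s) (r : Polynomial ℝ) :
    ∫ x in J, (AA δ β γ m s r).eval x * w x = 0 := by
  have h := H.ibplin (acp_poly H.oc r) (by
    have := H.ipolyq (r.derivative ^ 2)
    simpa using this)
  have e : ∀ x, (AA δ β γ m s r).eval x * w x =
      r.eval x * ((s * x - m) * w x) - r.derivative.eval x * (pq δ β γ x * w x) := by
    intro x; simp [AA, qP_eval]; ring
  simp_rw [e]
  have il : IntegrableOn (fun x => r.eval x * ((s * x - m) * w x)) J := by
    have := H.ipoly (r * (Polynomial.C s * Polynomial.X - Polynomial.C m))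
    simpa [mul_assoc] using this
  rw [integral_sub il (H.ipolyq _), h, sub_self]

lemma PW.vA (H : PW J δ β γ w m s) (r : Polynomial ℝ) {t : ℝ} (ht : t ∈ J) :
    ∫ x in J ∩ Set.Ici t, (AA δ β γ m s r).eval x * w x = r.eval t * (pq δ β γ t * w t) := by
  have iq := H.ipolyq (r.derivative ^ 2)
  have h := H.ibplin (acp_max r t) (by
    have := Integrable.indicator iq (measurableSet_Ici (a := t))
    refine this.congr ?_
    filter_upwards with x
    by_cases hx : x ∈ Set.Ici t <;> simp [hx])
  have e : ∀ x, (AA δ β γ m s r).eval x * w x =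
      r.eval x * ((s * x - m) * w x) - r.derivative.eval x * (pq δ β γ x * w x) := by
    intro x; simp [AA, qP_eval]; ring
  have il : IntegrableOn (fun x => r.eval x * ((s * x - m) * w x)) J := by
    have := H.ipoly (r * (Polynomial.C s * Polynomial.X - Polynomial.C m))
    simpa [mul_assoc] using this
  simp_rw [e]
  rw [integral_sub (il.mono_set Set.inter_subset_left) ((H.ipolyq _).mono_set Set.inter_subset_left)]
  have h2 : ∫ x in J, (Set.Ici t).indicator (fun x => r.derivative.eval x) x * (pq δ β γ x * w x) =
      ∫ x in J ∩ Set.Ici t, r.derivative.eval x * (pq δ β γ x * w x) := by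
    rw [← setIntegral_indicator measurableSet_Ici]
    congr 1; ext x
    by_cases hx : x ∈ Set.Ici t <;> simp [hx]
  have h3 : ∫ x in J, r.eval (max x t) * ((s * x - m) * w x) =
      (∫ x in J ∩ Set.Ici t, r.eval x * ((s * x - m) * w x)) - r.eval t * (pq δ β γ t * w t) := by
    have e2 : ∀ x, r.eval (max x t) * ((s * x - m) * w x) =
        (Set.Ici t).indicator (fun x => r.eval x * ((s * x - m) * w x)) x +
        r.eval t * (((s * x - m) * w x) - (Set.Ici t).indicator (fun x => (s * x - m) * w x) x) := by
      intro x
      by_cases hx : t ≤ x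
      · rw [max_eq_left hx]; simp [hx]
      · rw [max_eq_right (le_of_not_ge hx)]; simp [hx]
    simp_rw [e2]
    have j1 := Integrable.indicator H.ilin (measurableSet_Ici (a := t))
    have j2 : Integrable (fun x => ((s * x - m) * w x) - (Set.Ici t).indicator (fun x => (s * x - m) * w x) x) (volume.restrict J) := H.ilin.sub j1
    rw [integral_add (Integrable.indicator il measurableSet_Ici) (j2.const_mul _),
      setIntegral_indicator measurableSet_Ici, integral_const_mul, integral_sub H.ilin j1,
      setIntegral_indicator measurableSet_Ici, H.tail t ht, H.tot]
    ring
  rw [h2, h3] at h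
  linarith

lemma AA_q (x : ℝ) : (AA δ β γ m s (qP δ β γ)).eval x =
    ((s - 2 * δ) * x - (m + β)) * pq δ β γ x := by
  simp [AA, qP_eval]
  simp [qP]; ring

lemma zero_mem (op : IsOpen J) (oc : J.OrdConnected) (ne : J.Nonempty) (hs : 0 < s)
    (wp : ∀ x ∈ J, 0 < w x) (hi : IntegrableOn (fun x => (s * x - m) * w x) J)
    (h0 : ∫ x in J, (s * x - m) * w x = 0) : m / s ∈ J := by
  by_contra hn
  have mJ := oc.measurableSet
  have key : ∀ g : ℝ → ℝ, (∀ x ∈ J, 0 < g x) → IntegrableOn g J → ∫ x in J, g x ≠ 0 := by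
    intro g hg hgi h
    rw [integral_eq_zero_iff_of_nonneg_ae] at h
    · have : ∀ᵐ x ∂(volume.restrict J), False := by
        filter_upwards [h, ae_restrict_mem mJ] with x hx hxJ
        exact (hg x hxJ).ne' hx
      rw [ae_iff] at this
      simp at this
      exact (op.measure_pos volume ne).ne' this
    · filter_upwards [ae_restrict_mem mJ] with x hx
      exact (hg x hx).le
    · exact hgi
  obtain ⟨c, hc⟩ := ne
  have hcz : c ≠ m / s := fun h => hn (h ▸ hc)
  have e1 : ∀ x, s * x - m = s * (x - m / s) := by intro x; field_simp
  rcases lt_or_gt_of_ne hcz with h | h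
  · have hJ : ∀ x ∈ J, x < m / s := by
      intro x hx
      by_contra hx2
      exact hn (oc.out hc hx ⟨h.le, not_lt.1 hx2⟩)
    refine key (fun x => -((s * x - m) * w x)) ?_ hi.neg (by rw [integral_neg, h0, neg_zero])
    intro x hx
    rw [e1]
    have := hJ x hx
    have := wp x hx
    have : 0 < s * (m / s - x) * w x := by
      have : 0 < m / s - x := by linarith
      positivity
    linarith
  · have hJ : ∀ x ∈ J, m / s < x := by
      intro x hx
      by_contra hx2
      exact hn (oc.out hx hc ⟨not_lt.1 hx2, h.le⟩)
    refine key (fun x => ((s * x - m) * w x)) ?_ hi h0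
    intro x hx
    rw [e1]
    have := hJ x hx
    have := wp x hx
    have : 0 < x - m / s := by linarith
    positivity

lemma PW.next (H : PW J δ β γ w m s) :
    PW J δ β γ (fun x => pq δ β γ x * w x) (m + β) (s - 2 * δ) := by
  have hs : 0 < s - 2 * δ := by linarith [H.hs, H.hδ]
  have wp : ∀ x ∈ J, 0 < pq δ β γ x * w x := fun x hx => mul_pos (H.qp x hx) (H.wp x hx)
  have e : ∀ x, ((s - 2 * δ) * x - (m + β)) * (pq δ β γ x * w x) =
    (AA δ β γ m s (qP δ β γ)).eval x * w x := by
    intro x; rw [AA_q]; ring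
  have tot : ∫ x in J, ((s - 2 * δ) * x - (m + β)) * (pq δ β γ x * w x) = 0 := by
    simp_rw [e]; exact H.totA _
  have il : IntegrableOn (fun x => ((s - 2 * δ) * x - (m + β)) * (pq δ β γ x * w x)) J := by
    simp_rw [e]; exact H.ipoly _
  refine ⟨H.op, H.oc, H.hδ, hs, zero_mem H.op H.oc ⟨_, H.hz⟩ hs wp il tot, ?_, wp, H.qp, ?_, ?_, tot, ?_⟩
  · exact pq_cont.continuousOn.mul H.wc
  · simpa using H.ipolyq 1
  · simpa using H.ipolyq Polynomial.X
  · intro t ht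
    simp_rw [e]
    rw [H.vA _ ht, qP_eval]

lemma PW.ibpA (H : PW J δ β γ w m s) {u u' : ℝ → ℝ} (h : ACP J u u')
    (hu : IntegrableOn (fun t => u' t ^ 2 * (pq δ β γ t * w t)) J) (r : Polynomial ℝ) :
    ∫ x in J, u x * ((AA δ β γ m s r).eval x * w x) =
      ∫ t in J, u' t * (r.eval t * (pq δ β γ t * w t)) := by
  have := (H.ibp h hu (φ := fun x => (AA δ β γ m s r).eval x)
    ((Polynomial.continuous _).aestronglyMeasurable) (by
      have := H.ipoly ((AA δ β γ m s r) ^ 2)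
      simpa using this) (H.totA r)).2.2
  rw [this]
  refine setIntegral_congr_fun H.mJ fun t ht => ?_
  beta_reduce
  rw [H.vA r ht]

end

section
variable {J : Set ℝ} {δ β γ : ℝ} {w : ℝ → ℝ} {m s : ℝ}

lemma exh (op : IsOpen J) (oc : J.OrdConnected) {z : ℝ} (hz : z ∈ J) {h : ℝ → ℝ} (C : ℝ)
    (hc : ContinuousOn h J) (h0 : ∀ x ∈ J, 0 ≤ h x)
    (hb : ∀ a ∈ J, ∀ b ∈ J, a ≤ z → z ≤ b → ∫ x in a..b, h x ≤ C) :
    IntegrableOn h J ∧ ∫ x in J, h x ≤ C := by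
  have mJ := oc.measurableSet
  obtain ⟨F, hF1, hF2, hF3, hF4⟩ := op.exists_iUnion_isClosed
  set φ : ℕ → Set ℝ := fun n => F n ∩ Set.Icc (-n) n with hφ
  have cφ : ∀ n, IsCompact (φ n) := fun n => isCompact_Icc.inter_left (hF1 n)
  have sφ : ∀ n, φ n ⊆ J := fun n => Set.inter_subset_left.trans (hF2 n)
  have cov : AECover (volume.restrict J) atTop φ := by
    refine ⟨?_, fun n => (cφ n).measurableSet⟩
    filter_upwards [ae_restrict_mem mJ] with x hx
    rw [← hF3] at hx
    obtain ⟨N, hN⟩ := Set.mem_iUnion.1 hx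
    obtain ⟨M, hM⟩ := exists_nat_ge |x|
    filter_upwards [eventually_ge_atTop N, eventually_ge_atTop M] with n h1 h2
    refine ⟨hF4 h1 hN, ?_⟩
    have : (M:ℝ) ≤ n := by exact_mod_cast h2
    exact abs_le.1 (by linarith)
  have iφ : ∀ n, IntegrableOn h (φ n) := fun n => (hc.mono (sφ n)).integrableOn_compact (cφ n)
  have bφ : ∀ n, ∫ x in φ n, h x ∂(volume.restrict J) ≤ C := by
    intro n
    rw [Measure.restrict_restrict (cφ n).measurableSet, Set.inter_eq_left.2 (sφ n)]
    have cT : IsCompact (insert z (φ n)) := (cφ n).insert z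
    have sT : insert z (φ n) ⊆ J := Set.insert_subset hz (sφ n)
    have nT : (insert z (φ n)).Nonempty := Set.insert_nonempty _ _
    have ha := cT.sInf_mem nT
    have hb' := cT.sSup_mem nT
    set a := sInf (insert z (φ n))
    set b := sSup (insert z (φ n))
    have haz : a ≤ z := csInf_le cT.bddBelow (Set.mem_insert _ _)
    have hzb : z ≤ b := le_csSup cT.bddAbove (Set.mem_insert _ _)
    refine le_trans ?_ (hb a (sT ha) b (sT hb') haz hzb)
    rw [intervalIntegral.integral_of_le (haz.trans hzb), ← integral_Icc_eq_integral_Ioc]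
    have sI : Set.Icc a b ⊆ J := oc.out (sT ha) (sT hb')
    refine setIntegral_mono_set ((hc.mono sI).integrableOn_compact isCompact_Icc) ?_ ?_
    · filter_upwards [ae_restrict_mem measurableSet_Icc] with x hx
      exact h0 x (sI hx)
    · refine HasSubset.Subset.eventuallyLE fun x hx => ?_
      exact ⟨csInf_le cT.bddBelow (Set.mem_insert_of_mem _ hx), le_csSup cT.bddAbove (Set.mem_insert_of_mem _ hx)⟩
  have hI : Integrable h (volume.restrict J) := by
    refine cov.integrable_of_integral_bounded_of_nonneg_ae C (fun n => ?_) ?_ (Eventually.of_forall bφ)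
    · rw [IntegrableOn, Measure.restrict_restrict (cφ n).measurableSet, Set.inter_eq_left.2 (sφ n)]
      exact iφ n
    · filter_upwards [ae_restrict_mem mJ] with x hx
      exact h0 x hx
  exact ⟨hI, le_of_tendsto' (cov.integral_tendsto_of_countably_generated hI) bφ⟩

lemma acp_deriv (op : IsOpen J) {V ψ : ℝ → ℝ} (h : ACP J V ψ) (hc : ContinuousOn ψ J) {t : ℝ} (ht : t ∈ J) :
    HasDerivAt V (ψ t) t := by
  have h1 : HasDerivAt (fun x => V t + ∫ y in t..x, ψ y) (ψ t) t := by
    refine HasDerivAt.const_add _ ?_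
    refine intervalIntegral.integral_hasDerivAt_right (by simp) ?_ (hc.continuousAt (op.mem_nhds ht))
    exact hc.stronglyMeasurableAtFilter op t ht
  refine h1.congr_of_eventuallyEq ?_
  filter_upwards [op.mem_nhds ht] with x hx
  rw [← (h t ht x hx).2]; ring

lemma tail_split {ψ : ℝ → ℝ} (hi : IntegrableOn ψ J) (mJ : MeasurableSet J) (t : ℝ) :
    ∫ x in J ∩ Set.Ici t, ψ x = (∫ x in J, ψ x) - ∫ x in J ∩ Set.Iio t, ψ x := by
  have := integral_inter_add_diff (s := J) (t := Set.Ici t) (μ := volume) measurableSet_Ici hi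
  rw [← this]
  have e : J \ Set.Ici t = J ∩ Set.Iio t := by ext x; simp
  rw [e]; ring

lemma acp_tail (oc : J.OrdConnected) {ψ : ℝ → ℝ} (hi : IntegrableOn ψ J) :
    ACP J (fun t => ∫ x in J ∩ Set.Ici t, ψ x) (fun t => - ψ t) := by
  have mJ := oc.measurableSet
  intro a ha b hb
  have hs := oc.uIcc_subset ha hb
  have hii : IntervalIntegrable ψ volume a b := by
    rw [intervalIntegrable_iff]
    exact hi.mono_set (Set.uIoc_subset_uIcc.trans hs)
  refine ⟨hii.neg, ?_⟩
  have e : ∀ t, ∫ x in J ∩ Set.Ici t, ψ x = (∫ x in J, ψ x) - ∫ x in Set.Iic t, J.indicator ψ x := by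
    intro t
    rw [tail_split hi mJ, setIntegral_indicator mJ, Set.inter_comm (Set.Iic t)]
    congr 1
    refine setIntegral_congr_set ?_
    exact (ae_eq_refl J).inter Iio_ae_eq_Iic
  have hI : Integrable (J.indicator ψ) := (integrable_indicator_iff mJ).2 hi
  beta_reduce
  rw [e, e, intervalIntegral.integral_neg]
  have := intervalIntegral.integral_Iic_sub_Iic (a := a) (b := b) hI.integrableOn hI.integrableOn
  have h2 : ∫ x in a..b, J.indicator ψ x = ∫ x in a..b, ψ x := by
    refine intervalIntegral.integral_congr fun x hx => ?_
    exact Set.indicator_of_mem (hs hx) _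
  rw [h2] at this
  linarith

lemma sq_bound {S : Set ℝ} (hS : MeasurableSet S) {u : ℝ → ℝ} (wp : ∀ x ∈ S, 0 ≤ w x)
    (i0 : IntegrableOn w S) (i1 : IntegrableOn (fun x => u x * w x) S)
    (i2 : IntegrableOn (fun x => u x ^ 2 * w x) S) {T Q : ℝ} (hT : 0 ≤ T) (hQ : 0 < Q)
    (hTQ : T * ∫ x in S, w x ≤ Q) :
    T * (∫ x in S, u x * w x) ^ 2 / Q ≤ ∫ x in S, u x ^ 2 * w x := by
  set V := ∫ x in S, u x * w x
  set D := ∫ x in S, w x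
  set A := ∫ x in S, u x ^ 2 * w x
  have key : ∀ c : ℝ, 0 ≤ A - 2 * c * V + c ^ 2 * D := by
    intro c
    have : 0 ≤ ∫ x in S, (u x - c) ^ 2 * w x :=
      setIntegral_nonneg hS fun x hx => mul_nonneg (sq_nonneg _) (wp x hx)
    refine this.trans (le_of_eq ?_)
    have e : ∀ x, (u x - c) ^ 2 * w x = u x ^ 2 * w x - 2 * c * (u x * w x) + c ^ 2 * w x := by
      intro x; ring
    simp_rw [e]
    have j1 : Integrable (fun x => 2 * c * (u x * w x)) (volume.restrict S) := i1.const_mul (2 * c)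
    have j2 : Integrable (fun x => u x ^ 2 * w x - 2 * c * (u x * w x)) (volume.restrict S) := i2.sub j1
    rw [integral_add j2 (i0.const_mul _), integral_sub i2 j1,
      integral_const_mul, integral_const_mul]
  have h := key (V * T / Q)
  have h2 : (V * T / Q) ^ 2 * D ≤ T * V ^ 2 / Q := by
    have : (V * T / Q) ^ 2 * D = (T * V ^ 2 / Q ^ 2) * (T * D) := by field_simp
    rw [this]
    calc (T * V ^ 2 / Q ^ 2) * (T * D) ≤ (T * V ^ 2 / Q ^ 2) * Q := by gcongr
      _ = _ := by field_simp
  have h3 : 2 * (V * T / Q) * V = 2 * (T * V ^ 2 / Q) := by ring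
  linarith

lemma PW.dual (H : PW J δ β γ w m s) {u : ℝ → ℝ} (uc : ContinuousOn u J)
    (hu : IntegrableOn (fun x => u x ^ 2 * w x) J) (h0 : ∫ x in J, u x * w x = 0) :
    ∃ v v' : ℝ → ℝ, ACP J v v' ∧
      (∀ t ∈ J, ∫ x in J ∩ Set.Ici t, u x * w x = v t * (pq δ β γ t * w t)) ∧
      IntegrableOn (fun t => v t ^ 2 * (pq δ β γ t * w t)) J ∧
      IntegrableOn (fun t => v' t ^ 2 * (pq δ β γ t * (pq δ β γ t * w t))) J ∧
      (∫ t in J, v' t ^ 2 * (pq δ β γ t * (pq δ β γ t * w t))) +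
        s * (∫ t in J, v t ^ 2 * (pq δ β γ t * w t)) ≤ ∫ x in J, u x ^ 2 * w x := by
  have hs := H.hs
  have mJ := H.mJ
  have op := H.op
  have wp := H.wp
  have qp := H.qp
  have qc : ContinuousOn (pq δ β γ) J := pq_cont.continuousOn
  have um : AEStronglyMeasurable u (volume.restrict J) := uc.aestronglyMeasurable mJ
  have i1 : IntegrableOn (fun x => u x * w x) J := by
    refine (H.i0.add hu).mono' (um.mul H.i0.aestronglyMeasurable) ?_
    filter_upwards [ae_restrict_mem H.mJ] with x hx
    have := H.wp x hx
    rw [norm_mul, Real.norm_of_nonneg this.le, Real.norm_eq_abs]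
    simp only [Pi.add_apply]
    have : |u x| ≤ 1 + u x ^ 2 := by
      rw [← sq_abs]; nlinarith [sq_nonneg (|u x| - 1), abs_nonneg (u x)]
    nlinarith
  set q := pq δ β γ with hq
  set V : ℝ → ℝ := fun t => ∫ x in J ∩ Set.Ici t, u x * w x with hV
  set Q : ℝ → ℝ := fun t => ∫ x in J ∩ Set.Ici t, (s * x - m) * w x with hQ
  have Qe : ∀ t ∈ J, Q t = q t * w t := H.tail
  have Qp : ∀ t ∈ J, 0 < Q t := fun t ht => by rw [Qe t ht]; exact mul_pos (qp t ht) (wp t ht)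
  have dV : ∀ t ∈ J, HasDerivAt V (-(u t * w t)) t := fun t ht =>
    acp_deriv op (acp_tail H.oc i1) (uc.mul H.wc).neg ht
  have dQ : ∀ t ∈ J, HasDerivAt Q (-((s * t - m) * w t)) t := fun t ht =>
    acp_deriv op (acp_tail H.oc H.ilin) (ContinuousOn.mul (by fun_prop) H.wc).neg ht
  set v : ℝ → ℝ := fun t => V t / Q t with hv
  set v' : ℝ → ℝ := fun t => ((s * t - m) * v t - u t) / q t with hv'
  have dv : ∀ t ∈ J, HasDerivAt v (v' t) t := by
    intro t ht
    have h := (dV t ht).div (dQ t ht) (Qp t ht).ne'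
    refine HasDerivAt.congr_deriv h ?_
    have h1 := (qp t ht).ne'
    have h2 := (wp t ht).ne'
    have e1 : v' t = ((s * t - m) * (V t / Q t) - u t) / q t := rfl
    rw [e1, Qe t ht]
    field_simp
    ring
  have vc : ContinuousOn v J := fun t ht => (dv t ht).continuousAt.continuousWithinAt
  have v'c : ContinuousOn v' J := by
    refine ContinuousOn.div (((by fun_prop : ContinuousOn (fun t => s * t - m) J).mul vc).sub uc) qc fun t ht => (qp t ht).ne'
  have Vv : ∀ t ∈ J, V t = v t * (q t * w t) := by
    intro t ht
    rw [← Qe t ht]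
    exact (div_mul_cancel₀ _ (Qp t ht).ne').symm
  have acu := acp_tail H.oc hu
  set U : ℝ → ℝ := fun t => ∫ x in J ∩ Set.Ici t, u x ^ 2 * w x with hU
  have wc := H.wc
  have bR : ∀ b ∈ J, m / s ≤ b → (s * b - m) * (V b ^ 2 / Q b) ≤ U b := by
    intro b hb hz
    have hT : 0 ≤ s * b - m := by
      have := (div_le_iff₀ hs).1 hz; linarith
    have := sq_bound (S := J ∩ Set.Ici b) (w := w) (u := u) (T := s * b - m) (Q := Q b)
      (mJ.inter measurableSet_Ici) (fun x hx => (wp x hx.1).le)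
      (H.i0.mono_set Set.inter_subset_left) (i1.mono_set Set.inter_subset_left)
      (hu.mono_set Set.inter_subset_left) hT (Qp b hb) ?_
    · rwa [mul_div_assoc] at this
    · rw [← integral_const_mul]
      refine setIntegral_mono_on ((H.i0.mono_set Set.inter_subset_left).const_mul _)
        (H.ilin.mono_set Set.inter_subset_left) (mJ.inter measurableSet_Ici) ?_
      intro x hx
      have := (wp x hx.1).le
      have : b ≤ x := hx.2
      gcongr
  have bL : ∀ a ∈ J, a ≤ m / s → -(s * a - m) * (V a ^ 2 / Q a) ≤ (∫ x in J, u x ^ 2 * w x) - U a := by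
    intro a ha hz
    have hT : 0 ≤ -(s * a - m) := by
      have := (le_div_iff₀ hs).1 hz; linarith
    have := sq_bound (S := J ∩ Set.Iio a) (w := w) (u := u) (T := -(s * a - m)) (Q := Q a)
      (mJ.inter measurableSet_Iio) (fun x hx => (wp x hx.1).le)
      (H.i0.mono_set Set.inter_subset_left) (i1.mono_set Set.inter_subset_left)
      (hu.mono_set Set.inter_subset_left) hT (Qp a ha) ?_
    · have e1 : V a = -∫ x in J ∩ Set.Iio a, u x * w x := by
        simp only [hV]; rw [tail_split i1 mJ, h0]; ring
      have e2 : U a = (∫ x in J, u x ^ 2 * w x) - ∫ x in J ∩ Set.Iio a, u x ^ 2 * w x :=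
        tail_split hu mJ a
      rw [mul_div_assoc] at this
      rw [e1, e2, neg_sq]
      linarith
    · have e1 : Q a = ∫ x in J ∩ Set.Iio a, -((s * x - m) * w x) := by
        simp only [hQ]; rw [tail_split H.ilin mJ, H.tot, integral_neg]; ring
      rw [← integral_const_mul, e1]
      refine setIntegral_mono_on ((H.i0.mono_set Set.inter_subset_left).const_mul _)
        (H.ilin.mono_set Set.inter_subset_left).neg (mJ.inter measurableSet_Iio) ?_
      intro x hx
      have := (wp x hx.1).le
      have h1 : x ≤ a := le_of_lt hx.2
      rw [← neg_mul]
      gcongr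
  -- main bound
  have c1 : ContinuousOn (fun t => v' t ^ 2 * (q t * (q t * w t))) J := by fun_prop
  have c2 : ContinuousOn (fun t => v t ^ 2 * (q t * w t)) J := by fun_prop
  have main := exh op H.oc H.hz (h := fun t => v' t ^ 2 * (q t * (q t * w t)) + s * (v t ^ 2 * (q t * w t)))
    (∫ x in J, u x ^ 2 * w x) (by fun_prop) (fun x hx => by
      have := wp x hx; have := qp x hx; positivity) (by
    intro a ha b hb haz hzb
    have hs' := H.oc.uIcc_subset ha hb
    have dG : ∀ t ∈ Set.uIcc a b, HasDerivAt (fun t => (s * t - m) * (V t ^ 2 / Q t) - U t)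
        (v' t ^ 2 * (q t * (q t * w t)) + s * (v t ^ 2 * (q t * w t))) t := by
      intro t ht
      have ht := hs' ht
      have dU : HasDerivAt U (-(u t ^ 2 * w t)) t := acp_deriv op acu (by fun_prop) ht
      have d1 : HasDerivAt (fun t => s * t - m) s t := by
        simpa using ((hasDerivAt_id t).const_mul s).sub_const m
      have := (d1.mul (((dV t ht).pow 2).div (dQ t ht) (Qp t ht).ne')).sub dU
      refine HasDerivAt.congr_deriv this ?_
      have h1 := (qp t ht).ne'
      have h2 := (wp t ht).ne'
      have e1 : v' t = ((s * t - m) * (V t / Q t) - u t) / q t := rfl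
      have e2 : v t = V t / Q t := rfl
      rw [e1, e2]
      simp only [Pi.pow_apply, Pi.div_apply, Nat.cast_ofNat]
      rw [Qe t ht]
      field_simp
      ring
    have := intervalIntegral.integral_eq_sub_of_hasDerivAt dG
      ((show ContinuousOn _ J by fun_prop).mono hs').intervalIntegrable
    rw [this]
    have := bR b hb hzb
    have := bL a ha haz
    linarith)
  have I1 : IntegrableOn (fun t => v' t ^ 2 * (q t * (q t * w t))) J := by
    refine main.1.mono' (c1.aestronglyMeasurable mJ) ?_
    filter_upwards [ae_restrict_mem mJ] with t ht
    have := wp t ht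
    have := qp t ht
    rw [Real.norm_of_nonneg (by positivity)]
    have : 0 ≤ s * (v t ^ 2 * (q t * w t)) := by positivity
    linarith
  have I2 : IntegrableOn (fun t => v t ^ 2 * (q t * w t)) J := by
    refine (main.1.const_mul (1/s)).mono' (c2.aestronglyMeasurable mJ) ?_
    filter_upwards [ae_restrict_mem mJ] with t ht
    have := wp t ht
    have := qp t ht
    rw [Real.norm_of_nonneg (by positivity), mul_add]
    have e : 1 / s * (s * (v t ^ 2 * (q t * w t))) = v t ^ 2 * (q t * w t) := by field_simp
    have : 0 ≤ 1 / s * (v' t ^ 2 * (q t * (q t * w t))) := by positivity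
    linarith
  refine ⟨v, v', acp_of_deriv H.oc dv v'c, Vv, I2, I1, ?_⟩
  refine le_trans (le_of_eq ?_) main.2
  rw [integral_add I1 (I2.const_mul s), integral_const_mul]

end

section
variable {J : Set ℝ} {δ β γ : ℝ} {w : ℝ → ℝ} {m s : ℝ}

lemma exists_antideriv (p : Polynomial ℝ) {k : ℕ} (hk : p.natDegree ≤ k) :
    ∃ P : Polynomial ℝ, P.derivative = p ∧ P.natDegree ≤ k + 1 := by
  refine ⟨∑ i ∈ Finset.range (k+1), Polynomial.monomial (i+1) (p.coeff i / (i+1)), ?_, ?_⟩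
  · rw [Polynomial.derivative_sum]
    conv_rhs => rw [p.as_sum_range' (k+1) (by omega)]
    refine Finset.sum_congr rfl fun i _ => ?_
    rw [Polynomial.derivative_monomial]
    congr 1
    have : (i:ℝ) + 1 ≠ 0 := by positivity
    push_cast
    field_simp
  · refine Polynomial.natDegree_sum_le_of_forall_le _ _ fun i hi => ?_
    refine (Polynomial.natDegree_monomial_le _).trans ?_
    have := Finset.mem_range.1 hi
    omega

lemma acp_poly_of_ae (oc : J.OrdConnected) {u u' : ℝ → ℝ} (h : ACP J u u') {p : Polynomial ℝ} {d : ℕ}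
    (hd : p.natDegree ≤ d) (he : ∀ᵐ x ∂(volume.restrict J), u' x = p.eval x) :
    ∃ P : Polynomial ℝ, P.derivative = p ∧ P.natDegree ≤ d + 1 ∧ ∀ x ∈ J, u x = P.eval x := by
  obtain ⟨P, hP, hPd⟩ := exists_antideriv p hd
  rcases J.eq_empty_or_nonempty with hJ | ⟨z, hz⟩
  · exact ⟨P, hP, hPd, by simp [hJ]⟩
  refine ⟨P + Polynomial.C (u z - P.eval z), by simp [hP], by rwa [Polynomial.natDegree_add_C], fun x hx => ?_⟩
  have h1 := (h z hz x hx).2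
  have h2 := (acp_poly oc P z hz x hx).2
  have h3 : ∫ t in z..x, u' t = ∫ t in z..x, p.eval t := by
    refine intervalIntegral.integral_congr_ae ?_
    rw [ae_restrict_iff' oc.measurableSet] at he
    filter_upwards [he] with t ht hm
    exact ht (uIoc_sub oc hz hx hm)
  rw [hP] at h2
  simp
  linarith

lemma ae_zero_of_int {g q : ℝ → ℝ} (mJ : MeasurableSet J) (hq : ∀ x ∈ J, 0 < q x)
    (hi : IntegrableOn (fun x => g x ^ 2 * q x) J) (h : ∫ x in J, g x ^ 2 * q x = 0) :
    ∀ᵐ x ∂(volume.restrict J), g x = 0 := by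
  rw [integral_eq_zero_iff_of_nonneg_ae _ hi] at h
  · filter_upwards [h, ae_restrict_mem mJ] with x hx hxJ
    have := hq x hxJ
    simp only [Pi.zero_apply] at hx
    rcases mul_eq_zero.1 hx with h | h
    · exact pow_eq_zero_iff (two_ne_zero) |>.1 h
    · exact absurd h this.ne'
  · filter_upwards [ae_restrict_mem mJ] with x hxJ
    have := hq x hxJ
    simp only [Pi.zero_apply]
    positivity

lemma gap_step (H : PW J δ β γ w m s) {u u' v : ℝ → ℝ} (h : ACP J u u')
    (hu : IntegrableOn (fun t => u' t ^ 2 * (pq δ β γ t * w t)) J)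
    (hu2 : IntegrableOn (fun t => u t ^ 2 * w t) J)
    (h0 : ∫ x in J, u x * w x = 0)
    (hV : ∀ t ∈ J, ∫ x in J ∩ Set.Ici t, u x * w x = v t * (pq δ β γ t * w t))
    (hv : IntegrableOn (fun t => v t ^ 2 * (pq δ β γ t * w t)) J) {l : ℝ} (hl : 0 < l)
    (hN : l * ∫ t in J, v t ^ 2 * (pq δ β γ t * w t) ≤ ∫ x in J, u x ^ 2 * w x) :
    (l * ∫ x in J, u x ^ 2 * w x ≤ ∫ t in J, u' t ^ 2 * (pq δ β γ t * w t)) ∧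
    ((l * ∫ x in J, u x ^ 2 * w x = ∫ t in J, u' t ^ 2 * (pq δ β γ t * w t)) →
      (l * ∫ t in J, v t ^ 2 * (pq δ β γ t * w t) = ∫ x in J, u x ^ 2 * w x) ∧
      ∀ᵐ x ∂(volume.restrict J), u' x = l * v x) := by
  have um : AEStronglyMeasurable u (volume.restrict J) := (h.cont H.op).aestronglyMeasurable H.mJ
  obtain ⟨-, i2, e⟩ := H.ibp h hu um hu2 h0
  have qp : ∀ x ∈ J, 0 < pq δ β γ x * w x := fun x hx => mul_pos (H.qp x hx) (H.wp x hx)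
  have i3 : IntegrableOn (fun t => u' t * v t * (pq δ β γ t * w t)) J := by
    refine i2.congr_fun (fun t ht => ?_) H.mJ
    beta_reduce
    rw [hV t ht, mul_assoc]
  have e3 : ∫ x in J, u x ^ 2 * w x = ∫ t in J, u' t * v t * (pq δ β γ t * w t) := by
    have e1 : ∫ x in J, u x ^ 2 * w x = ∫ x in J, u x * (u x * w x) := by
      congr 1; ext x; ring
    rw [e1, e]
    refine setIntegral_congr_fun H.mJ fun t ht => ?_
    beta_reduce
    rw [hV t ht, mul_assoc]
  have e4 : ∀ t, (u' t - l * v t) ^ 2 * (pq δ β γ t * w t) = u' t ^ 2 * (pq δ β γ t * w t)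
      - 2 * l * (u' t * v t * (pq δ β γ t * w t)) + l ^ 2 * (v t ^ 2 * (pq δ β γ t * w t)) := by
    intro t; ring
  have j1 : Integrable (fun t => 2 * l * (u' t * v t * (pq δ β γ t * w t))) (volume.restrict J) :=
    Integrable.const_mul i3 (2*l)
  have j2 : Integrable (fun t => l ^ 2 * (v t ^ 2 * (pq δ β γ t * w t))) (volume.restrict J) :=
    Integrable.const_mul hv (l^2)
  have j3 : Integrable (fun t => u' t ^ 2 * (pq δ β γ t * w t)
      - 2 * l * (u' t * v t * (pq δ β γ t * w t))) (volume.restrict J) := hu.sub j1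
  have i4 : IntegrableOn (fun t => (u' t - l * v t) ^ 2 * (pq δ β γ t * w t)) J := by
    simp_rw [e4]
    exact j3.add j2
  have e5 : ∫ t in J, (u' t - l * v t) ^ 2 * (pq δ β γ t * w t) =
      (∫ t in J, u' t ^ 2 * (pq δ β γ t * w t)) - 2 * l * (∫ x in J, u x ^ 2 * w x) +
      l ^ 2 * ∫ t in J, v t ^ 2 * (pq δ β γ t * w t) := by
    simp_rw [e4]
    rw [integral_add j3 j2, integral_sub hu j1, integral_const_mul, integral_const_mul, e3]
  have h5 : 0 ≤ ∫ t in J, (u' t - l * v t) ^ 2 * (pq δ β γ t * w t) :=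
    setIntegral_nonneg H.mJ fun x hx => mul_nonneg (sq_nonneg _) (qp x hx).le
  set A := ∫ x in J, u x ^ 2 * w x
  set B := ∫ t in J, u' t ^ 2 * (pq δ β γ t * w t)
  set N := ∫ t in J, v t ^ 2 * (pq δ β γ t * w t)
  have hl2 : l ^ 2 * N ≤ l * A := by
    have := mul_le_mul_of_nonneg_left hN hl.le
    nlinarith
  refine ⟨by nlinarith, fun he => ?_⟩
  have z : ∫ t in J, (u' t - l * v t) ^ 2 * (pq δ β γ t * w t) = 0 := by nlinarith
  refine ⟨?_, ?_⟩
  · have : l * (l * N) = l * A := by nlinarith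
    exact mul_left_cancel₀ hl.ne' this
  · filter_upwards [ae_zero_of_int H.mJ qp i4 z] with x hx
    linarith

/-- the spectral gap -/
lemma gap (d : ℕ) : ∀ {w : ℝ → ℝ} {m s : ℝ}, PW J δ β γ w m s → ∀ {u u' : ℝ → ℝ}, ACP J u u' →
    IntegrableOn (fun t => u' t ^ 2 * (pq δ β γ t * w t)) J →
    (∀ p : Polynomial ℝ, p.natDegree ≤ d → ∫ x in J, u x * (p.eval x * w x) = 0) →
    (((d:ℝ) + 1) * (s - d * δ) * ∫ x in J, u x ^ 2 * w x ≤ ∫ t in J, u' t ^ 2 * (pq δ β γ t * w t)) ∧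
    ((((d:ℝ) + 1) * (s - d * δ) * ∫ x in J, u x ^ 2 * w x = ∫ t in J, u' t ^ 2 * (pq δ β γ t * w t)) →
      IsPolyOn u J (d + 1)) := by
  induction d with
  | zero =>
    intro w m s H u u' h hu ho
    have hu2 := H.usq h hu
    have h0 : ∫ x in J, u x * w x = 0 := by simpa using ho 1 (by simp)
    obtain ⟨v, v', av, hV, hv, hv', hle⟩ := H.dual (h.cont H.op) hu2 h0
    have qp : ∀ x ∈ J, 0 < pq δ β γ x * (pq δ β γ x * w x) := fun x hx =>
      mul_pos (H.qp x hx) (mul_pos (H.qp x hx) (H.wp x hx))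
    have hM : 0 ≤ ∫ t in J, v' t ^ 2 * (pq δ β γ t * (pq δ β γ t * w t)) :=
      setIntegral_nonneg H.mJ fun x hx => mul_nonneg (sq_nonneg _) (qp x hx).le
    have key := gap_step H h hu hu2 h0 hV hv H.hs (by linarith)
    simp only [Nat.cast_zero, zero_add, zero_mul, sub_zero, one_mul]
    refine ⟨key.1, fun he => ?_⟩
    obtain ⟨e1, e2⟩ := key.2 he
    have z := ae_zero_of_int H.mJ qp hv' (by linarith)
    obtain ⟨P, hP, -, hPe⟩ := acp_poly_of_ae (p := 0) (d := 0) H.oc av (by simp) (by simpa using z)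
    have hPd : P.natDegree ≤ 0 := (Polynomial.natDegree_eq_zero_of_derivative_eq_zero hP).le
    obtain ⟨R, -, hR, hRe⟩ := acp_poly_of_ae (p := Polynomial.C s * P) (d := 0) H.oc h
      ((Polynomial.natDegree_C_mul_le _ _).trans hPd) (by
        filter_upwards [e2, ae_restrict_mem H.mJ] with x hx hxJ
        rw [hx, hPe x hxJ]; simp)
    exact ⟨R, hR, hRe⟩
  | succ k ih =>
    intro w m s H u u' h hu ho
    have hu2 := H.usq h hu
    have h0 : ∫ x in J, u x * w x = 0 := by simpa using ho 1 (by simp)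
    have um : AEStronglyMeasurable u (volume.restrict J) := (h.cont H.op).aestronglyMeasurable H.mJ
    obtain ⟨v, v', av, hV, hv, hv', hle⟩ := H.dual (h.cont H.op) hu2 h0
    have orth : ∀ p : Polynomial ℝ, p.natDegree ≤ k →
        ∫ x in J, v x * (p.eval x * (pq δ β γ x * w x)) = 0 := by
      intro p hp
      obtain ⟨P, hP, hPd⟩ := exists_antideriv p hp
      have := (H.ibp (acp_poly H.oc P) (by
        have := H.ipolyq (P.derivative ^ 2)
        simpa using this) um hu2 h0).2.2
      have e1 : ∫ x in J, P.eval x * (u x * w x) = 0 := by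
        rw [← ho P hPd]; congr 1; ext x; ring
      rw [e1, hP] at this
      rw [this]
      refine setIntegral_congr_fun H.mJ fun t ht => ?_
      beta_reduce
      rw [hV t ht]; ring
    have I := ih H.next av hv' orth
    have hl : 0 < ((k:ℝ) + 1 + 1) * (s - (k+1) * δ) := by
      have := H.hs; have := H.hδ
      have : 0 ≤ ((k:ℝ)+1) * -δ := mul_nonneg (by positivity) (by linarith)
      have : 0 < s - (k+1) * δ := by linarith
      positivity
    have el : ((k:ℝ) + 1 + 1) * (s - (k+1) * δ) = ((k:ℝ)+1) * (s - 2 * δ - k * δ) + s := by ring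
    have key := gap_step H h hu hu2 h0 hV hv hl (by rw [el, add_mul]; linarith [I.1])
    push_cast
    refine ⟨key.1, fun he => ?_⟩
    obtain ⟨e1, e2⟩ := key.2 he
    rw [el, add_mul] at e1
    obtain ⟨P, hPd, hPe⟩ := I.2 (by linarith [I.1])
    obtain ⟨R, -, hR, hRe⟩ := acp_poly_of_ae (p := Polynomial.C _ * P) (d := k+1) H.oc h
      ((Polynomial.natDegree_C_mul_le _ _).trans hPd) (by
        filter_upwards [e2, ae_restrict_mem H.mJ] with x hx hxJ
        rw [hx, hPe x hxJ, Polynomial.eval_mul, Polynomial.eval_C])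
    exact ⟨R, hR, hRe⟩

end

section
variable {J : Set ℝ} {δ β γ : ℝ} {w : ℝ → ℝ} {m s : ℝ}

lemma acp_ae_deriv (op : IsOpen J) {u u' : ℝ → ℝ} (h : ACP J u u') :
    ∀ᵐ x ∂(volume.restrict J), HasDerivAt u (u' x) x := by
  rw [ae_restrict_iff' op.measurableSet]
  have key : ∀ᵐ x : ℝ, ∀ a b : ℚ, (a:ℝ) ∈ J → (b:ℝ) ∈ J → x ∈ Set.uIcc (a:ℝ) b →
      HasDerivAt (fun x => ∫ (t : ℝ) in (a:ℝ)..x, u' t) (u' x) x := by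
    rw [ae_all_iff]; intro a
    rw [ae_all_iff]; intro b
    by_cases ha : (a:ℝ) ∈ J
    · by_cases hb : (b:ℝ) ∈ J
      · filter_upwards [(h a ha b hb).1.ae_hasDerivAt_integral] with x hx _ _ hm
        exact hx hm _ Set.left_mem_uIcc
      · simp [hb]
    · simp [ha]
  filter_upwards [key] with x hx hxJ
  obtain ⟨a, b, hab, hs⟩ := mem_nhds_iff_exists_Ioo_subset.1 (op.mem_nhds hxJ)
  obtain ⟨a', ha⟩ := exists_rat_btwn hab.1
  obtain ⟨b', hb⟩ := exists_rat_btwn hab.2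
  have haJ : (a':ℝ) ∈ J := (hs ⟨ha.1, by linarith [hab.2]⟩)
  have hbJ : (b':ℝ) ∈ J := (hs ⟨by linarith [hab.1], hb.2⟩)
  have h1 := (hx a' b' haJ hbJ (Set.mem_uIcc_of_le ha.2.le hb.1.le)).const_add (u a')
  refine h1.congr_of_eventuallyEq ?_
  filter_upwards [op.mem_nhds hxJ] with y hy
  rw [← (h a' haJ y hy).2]; ring

lemma acp_ae_poly (op : IsOpen J) {u u' : ℝ → ℝ} (h : ACP J u u') {P : Polynomial ℝ}
    (hP : ∀ x ∈ J, u x = P.eval x) :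
    ∀ᵐ x ∂(volume.restrict J), u' x = P.derivative.eval x := by
  filter_upwards [acp_ae_deriv op h, ae_restrict_mem op.measurableSet] with x hx hxJ
  have : HasDerivAt u (P.derivative.eval x) x := by
    refine (P.hasDerivAt x).congr_of_eventuallyEq ?_
    filter_upwards [op.mem_nhds hxJ] with y hy using hP y hy
  exact hx.unique this

/-- iterated weights -/
lemma PW.iter (H : PW J δ β γ w m s) (k : ℕ) :
    PW J δ β γ (fun x => pq δ β γ x ^ k * w x) (m + k * β) (s - 2 * k * δ) := by
  induction k with
  | zero => simpa using H
  | succ k ih =>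
    have := ih.next
    have e1 : (fun x => pq δ β γ x * (pq δ β γ x ^ k * w x)) = fun x => pq δ β γ x ^ (k+1) * w x := by
      ext x; rw [pow_succ']; ring
    have e2 : m + k * β + β = m + ((k+1:ℕ):ℝ) * β := by push_cast; ring
    have e3 : s - 2 * k * δ - 2 * δ = s - 2 * ((k+1:ℕ):ℝ) * δ := by push_cast; ring
    rw [e1, e2, e3] at this
    exact this

lemma AA_coeff (r : Polynomial ℝ) (n : ℕ) : (AA δ β γ m s r).coeff (n+1) =
    (s - n * δ) * r.coeff n - m * r.coeff (n+1) - β * ((n+1) * r.coeff (n+1)) - γ * ((n+2) * r.coeff (n+2)) := by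
  unfold AA qP
  simp only [sub_mul, add_mul, Polynomial.coeff_sub, Polynomial.coeff_add, mul_assoc, Polynomial.coeff_C_mul,
    Polynomial.coeff_X_mul, Polynomial.coeff_derivative]
  rcases n with _ | n
  · rw [Polynomial.coeff_X_pow_mul']
    simp
    ring
  · rw [Polynomial.coeff_X_pow_mul']
    simp [Polynomial.coeff_derivative]
    ring

lemma AA_deg {r : Polynomial ℝ} {d : ℕ} (h : r.natDegree ≤ d) : (AA δ β γ m s r).natDegree ≤ d + 1 := by
  rw [Polynomial.natDegree_le_iff_coeff_eq_zero]
  intro N hN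
  obtain ⟨k, rfl⟩ : ∃ k, N = k + 1 := ⟨N - 1, by omega⟩
  rw [AA_coeff, Polynomial.coeff_eq_zero_of_natDegree_lt, Polynomial.coeff_eq_zero_of_natDegree_lt,
    Polynomial.coeff_eq_zero_of_natDegree_lt] <;> try omega
  simp

lemma AA_lead {r : Polynomial ℝ} {d : ℕ} (h : r.natDegree ≤ d) :
    (AA δ β γ m s r).coeff (d+1) = (s - d * δ) * r.coeff d := by
  rw [AA_coeff, Polynomial.coeff_eq_zero_of_natDegree_lt (n := d+1) (by omega),
    Polynomial.coeff_eq_zero_of_natDegree_lt (n := d+2) (by omega)]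
  simp

lemma AA_add (r t : Polynomial ℝ) : AA δ β γ m s (r + t) = AA δ β γ m s r + AA δ β γ m s t := by
  unfold AA; simp; ring

lemma deg_drop {p : Polynomial ℝ} {d : ℕ} (h : p.natDegree ≤ d + 1) (h0 : p.coeff (d+1) = 0) :
    p.natDegree ≤ d := by
  rw [Polynomial.natDegree_le_iff_coeff_eq_zero] at h ⊢
  intro N hN
  rcases (show N = d + 1 ∨ d + 1 < N by omega) with rfl | h1
  · exact h0
  · exact h N h1

lemma PW.sd (H : PW J δ β γ w m s) (d : ℕ) : 0 < s - d * δ := by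
  have := H.hs
  have : 0 ≤ (d:ℝ) * -δ := mul_nonneg (by positivity) (by linarith [H.hδ])
  linarith

lemma PW.surj (H : PW J δ β γ w m s) (d : ℕ) : ∀ p : Polynomial ℝ, p.natDegree ≤ d + 1 →
    ∃ (c : ℝ) (r : Polynomial ℝ), r.natDegree ≤ d ∧ p = Polynomial.C c + AA δ β γ m s r := by
  induction d with
  | zero =>
    intro p hp
    have hs := (H.sd 0).ne'
    set r0 : Polynomial ℝ := Polynomial.monomial 0 (p.coeff 1 / (s - (0:ℕ) * δ)) with hr0
    have hr : r0.natDegree ≤ 0 := Polynomial.natDegree_monomial_le _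
    have h1 : (p - AA δ β γ m s r0).natDegree ≤ 0 := by
      refine deg_drop ((Polynomial.natDegree_sub_le_of_le hp (AA_deg hr)).trans (by simp)) ?_
      rw [Polynomial.coeff_sub, AA_lead hr, hr0, Polynomial.coeff_monomial, if_pos rfl]
      rw [mul_div_cancel₀ _ hs]; simp
    refine ⟨(p - AA δ β γ m s r0).coeff 0, r0, hr, ?_⟩
    · rw [← Polynomial.eq_C_of_natDegree_le_zero h1]; ring
  | succ d ih =>
    intro p hp
    have hs := (H.sd (d+1)).ne'
    set r0 : Polynomial ℝ := Polynomial.monomial (d+1) (p.coeff (d+1+1) / (s - (d+1:ℕ) * δ)) with hr0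
    have hr : r0.natDegree ≤ d + 1 := Polynomial.natDegree_monomial_le _
    have h1 : (p - AA δ β γ m s r0).natDegree ≤ d + 1 := by
      refine deg_drop ((Polynomial.natDegree_sub_le_of_le hp (AA_deg hr)).trans (by simp)) ?_
      rw [Polynomial.coeff_sub, AA_lead hr, hr0, Polynomial.coeff_monomial, if_pos rfl]
      rw [mul_div_cancel₀ _ hs]; simp
    obtain ⟨c, r, hrd, he⟩ := ih _ h1
    refine ⟨c, r + r0, (Polynomial.natDegree_add_le_of_le (hrd.trans (Nat.le_succ d)) hr).trans (by simp), ?_⟩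
    rw [AA_add, ← add_assoc, ← he]; ring

lemma PW.orth_step (H : PW J δ β γ w m s) {u u' : ℝ → ℝ} (h : ACP J u u')
    (hu : IntegrableOn (fun t => u' t ^ 2 * (pq δ β γ t * w t)) J) {d : ℕ}
    (h0 : ∫ x in J, u x * w x = 0)
    (ho : ∀ p : Polynomial ℝ, p.natDegree ≤ d → ∫ x in J, u' x * (p.eval x * (pq δ β γ x * w x)) = 0) :
    ∀ p : Polynomial ℝ, p.natDegree ≤ d + 1 → ∫ x in J, u x * (p.eval x * w x) = 0 := by
  intro p hp
  obtain ⟨c, r, hr, rfl⟩ := H.surj d p hp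
  have um : AEStronglyMeasurable u (volume.restrict J) := (h.cont H.op).aestronglyMeasurable H.mJ
  have hu2 := H.usq h hu
  have i1 : IntegrableOn (fun x => u x * ((AA δ β γ m s r).eval x * w x)) J :=
    (H.ibp h hu (Polynomial.continuous _).aestronglyMeasurable (by
      have := H.ipoly ((AA δ β γ m s r) ^ 2)
      simpa using this) (H.totA r)).1
  by_cases hc : c = 0
  · subst hc
    simp only [map_zero, zero_add]
    rw [H.ibpA h hu, ho r hr]
  have i2 : IntegrableOn (fun x => u x * w x) J := by
    refine (H.i0.add hu2).mono' (um.mul H.i0.aestronglyMeasurable) ?_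
    filter_upwards [ae_restrict_mem H.mJ] with x hx
    have := H.wp x hx
    rw [norm_mul, Real.norm_of_nonneg this.le, Real.norm_eq_abs]
    simp only [Pi.add_apply]
    have : |u x| ≤ 1 + u x ^ 2 := by
      rw [← sq_abs]; nlinarith [sq_nonneg (|u x| - 1), abs_nonneg (u x)]
    nlinarith
  have e : ∀ x, u x * ((Polynomial.C c + AA δ β γ m s r).eval x * w x) =
      c * (u x * w x) + u x * ((AA δ β γ m s r).eval x * w x) := by
    intro x; simp; ring
  simp_rw [e]
  rw [integral_add (i2.const_mul c) i1, integral_const_mul, h0, H.ibpA h hu, ho r hr]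
  simp

lemma PW.link_eq (H : PW J δ β γ w m s) {u u' : ℝ → ℝ} (h : ACP J u u') {d : ℕ}
    (ho : ∀ p : Polynomial ℝ, p.natDegree ≤ d → ∫ x in J, u x * (p.eval x * w x) = 0)
    {P : Polynomial ℝ} (hP : P.natDegree ≤ d + 1) (he : ∀ x ∈ J, u x = P.eval x) :
    ((d:ℝ) + 1) * (s - d * δ) * ∫ x in J, u x ^ 2 * w x = ∫ t in J, u' t ^ 2 * (pq δ β γ t * w t) := by
  have hP' : P.derivative.natDegree ≤ d := (Polynomial.natDegree_derivative_le P).trans (by omega)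
  have e1 : ∫ t in J, u' t ^ 2 * (pq δ β γ t * w t) =
      ∫ t in J, P.derivative.eval t * (P.derivative.eval t * (pq δ β γ t * w t)) := by
    refine integral_congr_ae ?_
    filter_upwards [acp_ae_poly H.op h he] with x hx
    rw [hx]; ring
  have i1 := H.ipolyq (P.derivative ^ 2)
  rw [e1, ← H.ibpA (acp_poly H.oc P) (by simpa using i1)]
  set l := ((d:ℝ) + 1) * (s - d * δ) with hl
  set R := AA δ β γ m s P.derivative - Polynomial.C l * P with hR
  have hRd : R.natDegree ≤ d := by
    refine deg_drop ((Polynomial.natDegree_sub_le_of_le (AA_deg hP')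
      ((Polynomial.natDegree_C_mul_le _ _).trans hP)).trans (by simp)) ?_
    rw [hR, Polynomial.coeff_sub, AA_lead hP', Polynomial.coeff_derivative, Polynomial.coeff_C_mul, hl]
    ring
  have e2 := ho R hRd
  have e3 : ∫ x in J, u x * (R.eval x * w x) =
      (∫ x in J, P.eval x * ((AA δ β γ m s P.derivative).eval x * w x)) - l * ∫ x in J, u x ^ 2 * w x := by
    rw [← integral_const_mul, ← integral_sub]
    · refine setIntegral_congr_fun H.mJ fun t ht => ?_
      simp only [he t ht, hR]
      simp; ring
    · have := H.ipoly (P * AA δ β γ m s P.derivative)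
      simpa [mul_assoc, IntegrableOn] using this
    · refine Integrable.const_mul ?_ _
      refine IntegrableOn.congr_fun (H.ipoly (P^2)) (fun t ht => ?_) H.mJ
      simp [he t ht]
  linarith

/-- chain constant -/
def cc (δ s : ℝ) (k : ℕ) : ℝ := ((k+1).factorial : ℝ) * ∏ t ∈ Finset.range k, (s - (k + t) * δ)

lemma cc_succ (k : ℕ) : cc δ s (k+1) = (((k+1:ℕ):ℝ) + 1) * (s - (k+1:ℕ) * δ) * cc δ (s - 2 * δ) k := by
  unfold cc
  rw [Finset.prod_range_succ', Nat.factorial_succ (k+1)]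
  have : ∀ t : ℕ, s - (((k+1:ℕ):ℝ) + ((t+1:ℕ):ℝ)) * δ = s - 2 * δ - (k + t) * δ := by
    intro t; push_cast; ring
  simp_rw [this]
  push_cast
  ring

lemma PW.cc_pos (H : PW J δ β γ w m s) (k : ℕ) : 0 < cc δ s k := by
  unfold cc
  refine mul_pos (by positivity) (Finset.prod_pos fun t _ => ?_)
  have := H.sd (k + t)
  push_cast at this
  exact this

lemma chain (k : ℕ) : ∀ {w : ℝ → ℝ} {m s : ℝ}, PW J δ β γ w m s → ∀ {G : ℕ → ℝ → ℝ},
    (∀ j < k, ACP J (G j) (G (j+1))) →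
    IntegrableOn (fun t => G k t ^ 2 * (pq δ β γ t ^ k * w t)) J →
    (∀ j ≤ k, ∫ x in J, G j x * (pq δ β γ x ^ j * w x) = 0) →
    IntegrableOn (fun t => G 0 t ^ 2 * w t) J ∧
    (∀ p : Polynomial ℝ, p.natDegree ≤ k → ∫ x in J, G 0 x * (p.eval x * w x) = 0) ∧
    (cc δ s k * ∫ x in J, G 0 x ^ 2 * w x ≤ ∫ t in J, G k t ^ 2 * (pq δ β γ t ^ k * w t)) ∧
    (1 ≤ k → (cc δ s k * ∫ x in J, G 0 x ^ 2 * w x = ∫ t in J, G k t ^ 2 * (pq δ β γ t ^ k * w t)) →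
      IsPolyOn (G 0) J (k + 1)) ∧
    ((∃ P : Polynomial ℝ, P.natDegree ≤ k + 1 ∧ ∀ᵐ x ∂(volume.restrict J), G 0 x = P.eval x) →
      cc δ s k * ∫ x in J, G 0 x ^ 2 * w x = ∫ t in J, G k t ^ 2 * (pq δ β γ t ^ k * w t)) := by
  induction k with
  | zero =>
    intro w m s H G _ hi h0
    simp only [pow_zero, one_mul] at hi h0
    refine ⟨hi, fun p hp => ?_, ?_, by simp, by simp [cc]⟩
    · rw [Polynomial.eq_C_of_natDegree_le_zero hp]
      have : ∀ x, G 0 x * ((Polynomial.C (p.coeff 0)).eval x * w x) = p.coeff 0 * (G 0 x * w x) := by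
        intro x; simp; ring
      simp_rw [this]
      rw [integral_const_mul]
      have := h0 0 le_rfl
      simp only [pow_zero, one_mul] at this
      rw [this, mul_zero]
    · simp [cc]
  | succ k ih =>
    intro w m s H G hA hi h0
    have e : ∀ (j : ℕ) (x : ℝ), pq δ β γ x ^ (j+1) * w x = pq δ β γ x ^ j * (pq δ β γ x * w x) := by
      intro j x; ring
    simp_rw [e] at hi ⊢
    obtain ⟨a, b, c, d', f⟩ := ih H.next (G := fun j => G (j+1)) (fun j hj => hA (j+1) (by omega)) hi
      (fun j hj => by have := h0 (j+1) (by omega); simpa only [e] using this)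
    simp only [zero_add] at a b c d' f
    have h := hA 0 (by omega)
    simp only [zero_add] at h
    have h00 : ∫ x in J, G 0 x * w x = 0 := by simpa using h0 0 (by omega)
    have ho := H.orth_step h a h00 b
    have g := gap (k+1) H h a ho
    have cp := H.next.cc_pos k
    rw [cc_succ]
    set A := ∫ x in J, G 0 x ^ 2 * w x
    set B := ∫ x in J, G 1 x ^ 2 * (pq δ β γ x * w x)
    set l := (((k+1:ℕ):ℝ) + 1) * (s - (k+1:ℕ) * δ)
    have e2 : l * cc δ (s - 2 * δ) k * A = cc δ (s - 2 * δ) k * (l * A) := by ring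
    rw [e2]
    have hle := mul_le_mul_of_nonneg_left g.1 cp.le
    refine ⟨H.usq h a, ho, hle.trans c, fun _ he => ?_, ?_⟩
    · refine g.2 (le_antisymm g.1 ?_)
      have : cc δ (s - 2 * δ) k * B ≤ cc δ (s - 2 * δ) k * (l * A) := by linarith
      exact le_of_mul_le_mul_left this cp
    · rintro ⟨P, hP, hPe⟩
      have hPe' : ∀ x ∈ J, G 0 x = P.eval x :=
        Measure.eqOn_open_of_ae_eq hPe H.op (h.cont H.op) P.continuous.continuousOn
      have := H.link_eq h ho hP hPe'
      rw [this]
      exact f ⟨P.derivative, (Polynomial.natDegree_derivative_le P).trans (by omega), acp_ae_poly H.op h hPe'⟩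

end

section
variable {J : Set ℝ} {δ β γ : ℝ} {w : ℝ → ℝ} {m s : ℝ}

/-- leading coefficient of the Rodrigues polynomial -/
def kap (δ s : ℝ) (n : ℕ) : ℝ := ∏ j ∈ Finset.range n, (s - ((n:ℝ) - 1 + j) * δ)

lemma kap_succ (n : ℕ) : kap δ s (n+1) = (s - n * δ) * kap δ (s - 2 * δ) n := by
  unfold kap
  rw [Finset.prod_range_succ']
  have : ∀ t : ℕ, s - (((n+1:ℕ):ℝ) - 1 + ((t+1:ℕ):ℝ)) * δ = s - 2 * δ - ((n:ℝ) - 1 + t) * δ := by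
    intro t; push_cast; ring
  simp_rw [this]
  push_cast
  ring

lemma PW.kap_pos (H : PW J δ β γ w m s) (n : ℕ) : 0 < kap δ s n := by
  unfold kap
  refine Finset.prod_pos fun t ht => ?_
  have h1 : 1 ≤ n := by have := Finset.mem_range.1 ht; omega
  have := H.sd (n - 1 + t)
  push_cast [h1] at this
  exact this

/-- Rodrigues polynomials -/
def Rod (δ β γ : ℝ) : ℝ → ℝ → ℕ → Polynomial ℝ
  | _, _, 0 => 1
  | m, s, n+1 => AA δ β γ m s (Rod δ β γ (m + β) (s - 2 * δ) n)

lemma Rod_deg (n : ℕ) : ∀ m s : ℝ, (Rod δ β γ m s n).natDegree ≤ n := by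
  induction n with
  | zero => intro m s; simp [Rod]
  | succ n ih => intro m s; exact AA_deg (ih _ _)

lemma Rod_lead (n : ℕ) : ∀ m s : ℝ, (Rod δ β γ m s n).coeff n = kap δ s n := by
  induction n with
  | zero => intro m s; simp [Rod, kap]
  | succ n ih => intro m s; rw [Rod, AA_lead (Rod_deg n _ _), ih, kap_succ]

lemma Rod_int (n : ℕ) : ∀ {w : ℝ → ℝ} {m s : ℝ}, PW J δ β γ w m s → ∀ p : Polynomial ℝ,
    ∫ x in J, (p * Rod δ β γ m s n).eval x * w x =
      ∫ x in J, (Polynomial.derivative^[n] p).eval x * (pq δ β γ x ^ n * w x) := by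
  induction n with
  | zero => intro w m s H p; simp [Rod]
  | succ n ih =>
    intro w m s H p
    have h1 := H.ibpA (acp_poly H.oc p) (by
      have := H.ipolyq (p.derivative ^ 2)
      simpa using this) (Rod δ β γ (m + β) (s - 2 * δ) n)
    have h2 := ih H.next p.derivative
    simp only [Polynomial.eval_mul, Rod, mul_assoc, Function.iterate_succ_apply] at h1 h2 ⊢
    rw [h1, h2]
    congr 1; ext x; rw [pow_succ]; ring

lemma iter_top {p : Polynomial ℝ} {n : ℕ} (h : p.natDegree ≤ n) :
    Polynomial.derivative^[n] p = Polynomial.C ((n.factorial : ℝ) * p.coeff n) := by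
  ext k
  rw [Polynomial.coeff_iterate_derivative, Polynomial.coeff_C]
  split_ifs with hk
  · subst hk; simp [Nat.descFactorial_self]
  · rw [Polynomial.coeff_eq_zero_of_natDegree_lt (by omega)]; simp

/-- integration functional -/
def PW.L (H : PW J δ β γ w m s) : Polynomial ℝ →ₗ[ℝ] ℝ where
  toFun p := ∫ x in J, p.eval x * w x
  map_add' p r := by
    rw [← integral_add (H.ipoly p) (H.ipoly r)]
    congr 1; ext x; simp; ring
  map_smul' c p := by
    simp only [RingHom.id_apply, smul_eq_mul]
    rw [← integral_const_mul]
    congr 1; ext x; simp; ring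

lemma PW.L_def (H : PW J δ β γ w m s) (p : Polynomial ℝ) : H.L p = ∫ x in J, p.eval x * w x := rfl

/-- moments of q -/
def II (J : Set ℝ) (δ β γ : ℝ) (w : ℝ → ℝ) (i : ℕ) : ℝ := ∫ x in J, pq δ β γ x ^ i * w x

lemma PW.I_pos (H : PW J δ β γ w m s) (i : ℕ) : 0 < II J δ β γ w i := by
  have K := H.iter i
  unfold II
  have hn : 0 ≤ ∫ x in J, pq δ β γ x ^ i * w x := setIntegral_nonneg H.mJ fun x hx => (K.wp x hx).le
  refine lt_of_le_of_ne hn fun h0 => ?_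
  have h1 := ae_zero_of_int (g := fun _ => 1) H.mJ K.wp (by simpa using K.i0) (by simpa using h0.symm)
  have h2 : volume J = 0 := by
    have : ∀ᵐ x ∂(volume.restrict J), False := by filter_upwards [h1] with x hx; simp at hx
    rw [ae_restrict_iff' H.mJ] at this
    rw [← compl_compl J]
    exact (mem_ae_iff).1 (by filter_upwards [this] with x hx; exact hx)
  exact (H.op.measure_pos volume ⟨_, H.hz⟩).ne' h2

lemma PW.int_top (H : PW J δ β γ w m s) {p : Polynomial ℝ} {n : ℕ} (h : p.natDegree ≤ n) :
    ∫ x in J, (p * Rod δ β γ m s n).eval x * w x = (n.factorial : ℝ) * p.coeff n * II J δ β γ w n := by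
  rw [Rod_int n H, iter_top h, II, ← integral_const_mul]
  simp

lemma PW.L_top (H : PW J δ β γ w m s) {p : Polynomial ℝ} {n : ℕ} (h : p.natDegree ≤ n) :
    H.L (p * Rod δ β γ m s n) = (n.factorial : ℝ) * p.coeff n * II J δ β γ w n := H.int_top h

lemma PW.L_orth (H : PW J δ β γ w m s) {i j : ℕ} (h : i ≠ j) :
    H.L (Rod δ β γ m s i * Rod δ β γ m s j) = 0 := by
  rcases Nat.lt_or_gt_of_ne h with h | h
  · rw [H.L_top ((Rod_deg i m s).trans h.le), Polynomial.coeff_eq_zero_of_natDegree_lt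
      ((Rod_deg i m s).trans_lt h)]; simp
  · rw [mul_comm, H.L_top ((Rod_deg j m s).trans h.le), Polynomial.coeff_eq_zero_of_natDegree_lt
      ((Rod_deg j m s).trans_lt h)]; simp

lemma PW.M_eq (H : PW J δ β γ w m s) (p r : Polynomial ℝ) :
    H.next.L (p.derivative * r.derivative) = H.L (AA δ β γ m s r.derivative * p) := by
  have h1 := H.ibpA (acp_poly H.oc p) (by
      have := H.ipolyq (p.derivative ^ 2)
      simpa using this) r.derivative
  rw [PW.L_def, PW.L_def]
  simp only [Polynomial.eval_mul, mul_assoc] at h1 ⊢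
  rw [← h1]
  congr 1; ext x; ring

lemma PW.M_orth_aux (H : PW J δ β γ w m s) {i j : ℕ} (h : j < i) :
    H.next.L ((Rod δ β γ m s i).derivative * (Rod δ β γ m s j).derivative) = 0 := by
  rw [H.M_eq]
  have hd : (AA δ β γ m s (Rod δ β γ m s j).derivative).natDegree < i := by
    rcases j with _ | j
    · simp [Rod, AA]; omega
    · refine (AA_deg (d := j) ?_).trans_lt h
      exact (Polynomial.natDegree_derivative_le _).trans (by have := Rod_deg (δ := δ) (β := β) (γ := γ) (j+1) m s; omega)
  rw [H.L_top hd.le, Polynomial.coeff_eq_zero_of_natDegree_lt hd]; simp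

lemma PW.M_orth (H : PW J δ β γ w m s) {i j : ℕ} (h : i ≠ j) :
    H.next.L ((Rod δ β γ m s i).derivative * (Rod δ β γ m s j).derivative) = 0 := by
  rcases Nat.lt_or_gt_of_ne h with h | h
  · rw [mul_comm (Polynomial.derivative _)]; exact H.M_orth_aux h
  · exact H.M_orth_aux h

lemma PW.M_diag (H : PW J δ β γ w m s) (j : ℕ) :
    H.next.L ((Rod δ β γ m s (j+1)).derivative * (Rod δ β γ m s (j+1)).derivative) =
      ((j:ℝ)+1) * (s - j * δ) * (((j+1).factorial : ℝ) * kap δ s (j+1) * II J δ β γ w (j+1)) := by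
  have hd : (Rod δ β γ m s (j+1)).derivative.natDegree ≤ j :=
    (Polynomial.natDegree_derivative_le _).trans (by have := Rod_deg (δ := δ) (β := β) (γ := γ) (j+1) m s; omega)
  rw [H.M_eq, H.L_top (AA_deg hd), AA_lead hd, Polynomial.coeff_derivative, Rod_lead]
  ring

/-- existence of the projection polynomial -/
lemma PW.exists_p (H : PW J δ β γ w m s) (k : ℕ) (D : ℕ → ℝ) :
    ∃ p : Polynomial ℝ, p.natDegree ≤ k + 1 ∧
      (∀ j ≤ k, ∫ x in J, (Polynomial.derivative^[j+1] p).eval x * (pq δ β γ x ^ (j+1) * w x) = D j) ∧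
      ∫ x in J, p.derivative.eval x ^ 2 * (pq δ β γ x * w x) =
        ∑ j ∈ Finset.range (k+1), ((j:ℝ)+1) * (s - j * δ) *
          (D j ^ 2 / (((j+1).factorial : ℝ) * kap δ s (j+1) * II J δ β γ w (j+1))) := by
  set c : ℕ → ℝ := fun j => ((j+1).factorial : ℝ) * kap δ s (j+1) * II J δ β γ w (j+1) with hc
  have cp : ∀ j, 0 < c j := fun j => by
    have := H.kap_pos (j+1); have := H.I_pos (j+1); simp only [hc]; positivity
  set p : Polynomial ℝ := ∑ j ∈ Finset.range (k+1), (D j / c j) • Rod δ β γ m s (j+1) with hp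
  refine ⟨p, ?_, ?_, ?_⟩
  · refine Polynomial.natDegree_sum_le_of_forall_le _ _ fun i hi => ?_
    refine (Polynomial.natDegree_smul_le _ _).trans ((Rod_deg _ _ _).trans ?_)
    have := Finset.mem_range.1 hi
    omega
  · intro j hj
    rw [← Rod_int (j+1) H p, ← H.L_def, hp, Finset.sum_mul, map_sum, Finset.sum_eq_single j]
    · rw [smul_mul_assoc, map_smul, H.L_top (Rod_deg _ _ _), Rod_lead, smul_eq_mul]
      exact div_mul_cancel₀ _ (cp j).ne'
    · intro i _ hij
      rw [smul_mul_assoc, map_smul, H.L_orth (by omega), smul_zero]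
    · intro h; exact absurd (Finset.mem_range.2 (by omega)) h
  · have e : ∫ x in J, p.derivative.eval x ^ 2 * (pq δ β γ x * w x) = H.next.L (p.derivative * p.derivative) := by
      rw [PW.L_def]; congr 1; ext x; rw [Polynomial.eval_mul]; ring
    rw [e, hp, Polynomial.derivative_sum, Finset.sum_mul_sum, map_sum]
    refine Finset.sum_congr rfl fun j hj => ?_
    rw [map_sum, Finset.sum_eq_single j]
    · rw [Polynomial.derivative_smul, smul_mul_smul_comm, map_smul, H.M_diag, smul_eq_mul]
      have := (cp j).ne'
      show D j / c j * (D j / c j) * (((j:ℝ)+1) * (s - j * δ) * c j) = ((j:ℝ)+1) * (s - j * δ) * (D j ^ 2 / c j)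
      field_simp
    · intro i _ hij
      rw [Polynomial.derivative_smul, Polynomial.derivative_smul, smul_mul_smul_comm, map_smul,
        H.M_orth (by omega), smul_zero]
    · intro h; exact absurd hj h

lemma PW.l1p (H : PW J δ β γ w m s) {u : ℝ → ℝ} (um : AEStronglyMeasurable u (volume.restrict J))
    (hu : IntegrableOn (fun x => u x ^ 2 * w x) J) (p : Polynomial ℝ) :
    IntegrableOn (fun x => u x * (p.eval x * w x)) J := by
  refine ((H.ipoly (p^2)).add hu).mono' (um.mul (H.ipoly p).aestronglyMeasurable) ?_
  filter_upwards [ae_restrict_mem H.mJ] with x hx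
  have := H.wp x hx
  rw [norm_mul, norm_mul, Real.norm_of_nonneg this.le, Real.norm_eq_abs, Real.norm_eq_abs]
  simp only [Pi.add_apply, Polynomial.eval_pow]
  have : |u x| * |p.eval x| ≤ (p.eval x) ^ 2 + u x ^ 2 := by
    rw [← sq_abs (u x), ← sq_abs (p.eval x)]
    nlinarith [sq_nonneg (|u x| - |p.eval x|), abs_nonneg (u x), abs_nonneg (p.eval x)]
  nlinarith

lemma PW.l1 (H : PW J δ β γ w m s) {u : ℝ → ℝ} (um : AEStronglyMeasurable u (volume.restrict J))
    (hu : IntegrableOn (fun x => u x ^ 2 * w x) J) : IntegrableOn (fun x => u x * w x) J := by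
  simpa using H.l1p um hu 1

lemma PW.subsq (H : PW J δ β γ w m s) {u : ℝ → ℝ} (um : AEStronglyMeasurable u (volume.restrict J))
    (hu : IntegrableOn (fun x => u x ^ 2 * w x) J) (p : Polynomial ℝ) :
    IntegrableOn (fun x => (u x - p.eval x) ^ 2 * w x) J := by
  have e : ∀ x, (u x - p.eval x) ^ 2 * w x = u x ^ 2 * w x - 2 * (u x * (p.eval x * w x)) + (p^2).eval x * w x := by
    intro x; simp; ring
  simp_rw [e]
  exact (hu.sub ((H.l1p um hu p).const_mul 2)).add (H.ipoly _)

lemma all_sq (H : PW J δ β γ w m s) {k : ℕ} {G : ℕ → ℝ → ℝ} (hA : ∀ j < k, ACP J (G j) (G (j+1)))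
    (hi : IntegrableOn (fun t => G k t ^ 2 * (pq δ β γ t ^ (k+1) * w t)) J) :
    ∀ i ≤ k, IntegrableOn (fun t => G (k - i) t ^ 2 * (pq δ β γ t ^ (k - i+1) * w t)) J := by
  intro i
  induction i with
  | zero => intro _; simpa using hi
  | succ i ih =>
    intro hik
    have h := ih (by omega)
    have e : k - i = k - (i+1) + 1 := by omega
    rw [e] at h
    refine (H.iter (k - (i+1) + 1)).usq (hA (k - (i+1)) (by omega)) ?_
    refine h.congr_fun (fun t _ => ?_) H.mJ
    simp only [pow_succ]; ring


lemma acp_sub_poly (oc : J.OrdConnected) {u u' : ℝ → ℝ} (h : ACP J u u') (p : Polynomial ℝ) :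
    ACP J (fun x => u x - p.eval x) (fun x => u' x - p.derivative.eval x) := by
  intro a ha b hb
  obtain ⟨h1, h2⟩ := h a ha b hb
  obtain ⟨h3, h4⟩ := acp_poly oc p a ha b hb
  refine ⟨h1.sub h3, ?_⟩
  rw [intervalIntegral.integral_sub h1 h3, ← h2, ← h4]
  ring

lemma main_abs (H : PW J δ β γ w m s) {k : ℕ} {G : ℕ → ℝ → ℝ} (hA : ∀ j < k, ACP J (G j) (G (j+1)))
    (hm : ∀ j ≤ k, AEStronglyMeasurable (G j) (volume.restrict J))
    (hi : IntegrableOn (fun t => G k t ^ 2 * (pq δ β γ t ^ (k+1) * w t)) J)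
    {D : ℕ → ℝ} (hD : ∀ j, D j = ∫ x in J, G j x * (pq δ β γ x ^ (j+1) * w x))
    {T A B c : ℝ} (hT : T = ∑ j ∈ Finset.range (k+1), ((j:ℝ)+1) * (s - j * δ) *
          (D j ^ 2 / (((j+1).factorial : ℝ) * kap δ s (j+1) * II J δ β γ w (j+1))))
    (hAe : A = ∫ x in J, G 0 x ^ 2 * (pq δ β γ x * w x))
    (hB : B = (∫ x in J, G k x ^ 2 * (pq δ β γ x ^ (k+1) * w x)) - D k ^ 2 / II J δ β γ w (k+1))
    (hc : c = cc δ (s - 2 * δ) k) :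
    c * (A - T) ≤ B ∧ (1 ≤ k → c * (A - T) = B → IsPolyOn (G 0) J (k+1)) ∧
    (k = 0 ∨ IsPolyOn (G 0) J (k+1) → c * (A - T) = B) := by
  obtain ⟨p, pd, pD, pT⟩ := H.exists_p k D
  have sq : ∀ j ≤ k, IntegrableOn (fun t => G j t ^ 2 * (pq δ β γ t ^ (j+1) * w t)) J := by
    intro j hj
    have := all_sq H hA hi (k - j) (by omega)
    rwa [show k - (k - j) = j by omega] at this
  set F : ℕ → ℝ → ℝ := fun j x => G j x - (Polynomial.derivative^[j+1] p).eval x with hF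
  have fA : ∀ j < k, ACP J (F j) (F (j+1)) := by
    intro j hj
    have := acp_sub_poly H.oc (hA j hj) (Polynomial.derivative^[j+1] p)
    rwa [← Function.iterate_succ_apply' Polynomial.derivative] at this
  have fsq : ∀ j ≤ k, IntegrableOn (fun t => F j t ^ 2 * (pq δ β γ t ^ (j+1) * w t)) J := fun j hj =>
    (H.iter (j+1)).subsq (hm j hj) (sq j hj) _
  have e : ∀ (j : ℕ) (x : ℝ), pq δ β γ x ^ j * (pq δ β γ x * w x) = pq δ β γ x ^ (j+1) * w x := by
    intro j x; ring
  have f0 : ∀ j ≤ k, ∫ x in J, F j x * (pq δ β γ x ^ (j+1) * w x) = 0 := by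
    intro j hj
    simp only [hF, sub_mul]
    rw [integral_sub ((H.iter (j+1)).l1 (hm j hj) (sq j hj)) ((H.iter (j+1)).ipoly _), pD j hj, hD j, sub_self]
  obtain ⟨h1, h2, h3, h4, h5⟩ := chain k H.next (G := F) fA (by simpa only [e] using fsq k le_rfl)
    (by simpa only [e] using f0)
  simp_rw [e] at h3 h4 h5
  have hA2 : A = (∫ x in J, F 0 x ^ 2 * (pq δ β γ x * w x)) + T := by
    rw [hAe, hT, ← pT]
    have o := h2 p.derivative ((Polynomial.natDegree_derivative_le p).trans (by omega))
    have m0 : AEStronglyMeasurable (F 0) (volume.restrict J) :=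
      (hm 0 (by omega)).sub (Polynomial.continuous _).aestronglyMeasurable
    have i1 := H.next.l1p m0 h1 p.derivative
    have i2 := H.next.ipoly (p.derivative ^ 2)
    simp only [Polynomial.eval_pow] at i2
    have ee : ∀ x, G 0 x ^ 2 * (pq δ β γ x * w x) = F 0 x ^ 2 * (pq δ β γ x * w x) +
        2 * (F 0 x * (p.derivative.eval x * (pq δ β γ x * w x))) + p.derivative.eval x ^ 2 * (pq δ β γ x * w x) := by
      intro x; simp only [hF, zero_add, Function.iterate_one]; ring
    simp_rw [ee]
    have j1 : Integrable (fun x => 2 * (F 0 x * (p.derivative.eval x * (pq δ β γ x * w x)))) (volume.restrict J) :=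
      Integrable.const_mul i1 2
    have j2 : Integrable (fun x => F 0 x ^ 2 * (pq δ β γ x * w x) +
      2 * (F 0 x * (p.derivative.eval x * (pq δ β γ x * w x)))) (volume.restrict J) := h1.add j1
    rw [integral_add j2 i2, integral_add h1 j1, integral_const_mul, o]
    ring
  have hB2 : B = ∫ x in J, F k x ^ 2 * (pq δ β γ x ^ (k+1) * w x) := by
    rw [hB]
    have t := iter_top pd
    set b := ((k+1).factorial : ℝ) * p.coeff (k+1)
    have pDk := pD k le_rfl
    rw [t] at pDk
    simp only [Polynomial.eval_C] at pDk
    rw [integral_const_mul] at pDk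
    have Ip := H.I_pos (k+1)
    have pDk : b * II J δ β γ w (k+1) = D k := pDk
    have ee : ∀ x, F k x ^ 2 * (pq δ β γ x ^ (k+1) * w x) = G k x ^ 2 * (pq δ β γ x ^ (k+1) * w x) -
        2 * b * (G k x * (pq δ β γ x ^ (k+1) * w x)) + b ^ 2 * (pq δ β γ x ^ (k+1) * w x) := by
      intro x; simp only [hF, t, Polynomial.eval_C]; ring
    simp_rw [ee]
    have K := H.iter (k+1)
    have j0 := K.l1 (hm k le_rfl) hi
    have j1 : Integrable (fun x => 2 * b * (G k x * (pq δ β γ x ^ (k+1) * w x))) (volume.restrict J) :=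
      Integrable.const_mul j0 _
    have j2 : Integrable (fun x => G k x ^ 2 * (pq δ β γ x ^ (k+1) * w x) -
        2 * b * (G k x * (pq δ β γ x ^ (k+1) * w x))) (volume.restrict J) := hi.sub j1
    have j3 : Integrable (fun x => b ^ 2 * (pq δ β γ x ^ (k+1) * w x)) (volume.restrict J) :=
      Integrable.const_mul K.i0 _
    rw [integral_add j2 j3, integral_sub hi j1, integral_const_mul, integral_const_mul, ← hD k]
    show _ = _ - _ + b ^ 2 * II J δ β γ w (k+1)
    rw [← pDk]
    field_simp
    ring
  have hAT : A - T = ∫ x in J, F 0 x ^ 2 * (pq δ β γ x * w x) := by rw [hA2]; ring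
  rw [hAT, hB2, hc]
  refine ⟨h3, fun hk he => ?_, ?_⟩
  · obtain ⟨P, hP, hPe⟩ := h4 hk he
    refine ⟨P + p.derivative, ?_, fun x hx => ?_⟩
    · refine (Polynomial.natDegree_add_le_of_le hP
        ((Polynomial.natDegree_derivative_le p).trans (show _ ≤ k + 1 by omega))).trans (by simp)
    · have := hPe x hx
      simp only [hF, zero_add, Function.iterate_one] at this
      rw [Polynomial.eval_add, ← this]; ring
  · rintro (h | ⟨P, hP, hPe⟩)
    · subst h; simp [cc]
    · refine h5 ⟨P - p.derivative, ?_, ?_⟩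
      · refine (Polynomial.natDegree_sub_le_of_le hP
          ((Polynomial.natDegree_derivative_le p).trans (show _ ≤ k + 1 by omega))).trans (by simp)
      · filter_upwards [ae_restrict_mem H.mJ] with x hx
        simp only [hF, zero_add, Function.iterate_one]
        rw [Polynomial.eval_sub, hPe x hx]

end

section
variable {J : Set ℝ} {δ β γ : ℝ} {w : ℝ → ℝ} {m s : ℝ}

lemma pos_int {S U : Set ℝ} {g : ℝ → ℝ} (hS : MeasurableSet S) (hU : IsOpen U) (ne : U.Nonempty) (hUS : U ⊆ S)
    (hg : ∀ x ∈ U, 0 < g x) (h0 : ∀ x ∈ S, 0 ≤ g x) (hi : IntegrableOn g S) : 0 < ∫ x in S, g x := by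
  rw [setIntegral_pos_iff_support_of_nonneg_ae ?_ hi]
  · refine (hU.measure_pos volume ne).trans_le (measure_mono fun x hx => ⟨(hg x hx).ne', hUS hx⟩)
  · filter_upwards [ae_restrict_mem hS] with x hx using h0 x hx

lemma pq_null (h : 0 < |δ| + |β| + |γ|) : volume {x : ℝ | pq δ β γ x = 0} = 0 := by
  have hq : qP δ β γ ≠ 0 := by
    intro h0
    have e : ∀ x, pq δ β γ x = 0 := fun x => by rw [← qP_eval, h0]; simp
    have e0 := e 0; have e1 := e 1; have e2 := e (-1)
    simp only [pq] at e0 e1 e2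
    have g0 : γ = 0 := by linarith
    have b0 : β = 0 := by linarith
    have d0 : δ = 0 := by linarith
    simp [g0, b0, d0] at h
  have := (Polynomial.finite_setOf_isRoot hq).measure_zero volume
  convert this using 2
  ext x
  simp [Polynomial.IsRoot, qP_eval]

lemma f_aem {f : ℝ → ℝ} {μ : ℝ} (hq : 0 < |δ| + |β| + |γ|)
    (h : ∀ x : ℝ, (∫ t in Set.Iic x, (μ - t) * f t) = pq δ β γ x * f x) : AEMeasurable f := by
  set T : Set ℝ := ⋃ r : {r : ℚ // IntegrableOn (fun t => (μ - t) * f t) (Set.Iic (r:ℝ))}, Set.Iic ((r:ℚ):ℝ) with hT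
  have mT : MeasurableSet T := MeasurableSet.iUnion fun _ => measurableSet_Iic
  have a1 : AEStronglyMeasurable (fun t => (μ - t) * f t) (volume.restrict T) := by
    rw [hT, aestronglyMeasurable_iUnion_iff]
    exact fun r => r.2.aestronglyMeasurable
  have a2 : AEStronglyMeasurable (fun t => (μ - t) * f t) (volume.restrict Tᶜ) := by
    refine AEStronglyMeasurable.congr (f := fun _ => (0:ℝ)) aestronglyMeasurable_const ?_
    have sub : Set.Subsingleton {x : ℝ | x ∉ T ∧ IntegrableOn (fun t => (μ - t) * f t) (Set.Iic x)} := by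
      have : ∀ x y : ℝ, x ∉ T → IntegrableOn (fun t => (μ - t) * f t) (Set.Iic y) → ¬ x < y := by
        intro x y hx hy hxy
        obtain ⟨r, hr⟩ := exists_rat_btwn hxy
        exact hx (Set.mem_iUnion.2 ⟨⟨r, hy.mono_set (Set.Iic_subset_Iic.2 hr.2.le)⟩, hr.1.le⟩)
      rintro x ⟨hx1, hx2⟩ y ⟨hy1, hy2⟩
      exact le_antisymm (not_lt.1 (this y x hy1 hx2)) (not_lt.1 (this x y hx1 hy2))
    have n1 : ∀ᵐ x : ℝ, ¬ (x ∉ T ∧ IntegrableOn (fun t => (μ - t) * f t) (Set.Iic x)) := by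
      rw [ae_iff]; simp only [not_not]; exact sub.measure_zero volume
    have n2 : ∀ᵐ x : ℝ, pq δ β γ x ≠ 0 := by
      rw [ae_iff]; simp only [ne_eq, not_not]; exact pq_null hq
    rw [EventuallyEq, ae_restrict_iff' mT.compl]
    filter_upwards [n1, n2] with x h1 h2 hx
    have h3 : ¬ IntegrableOn (fun t => (μ - t) * f t) (Set.Iic x) := fun h => h1 ⟨hx, h⟩
    have h4 := h x
    rw [integral_undef h3] at h4
    rcases mul_eq_zero.1 h4.symm with h5 | h5
    · exact absurd h5 h2
    · rw [h5, mul_zero]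
  have a3 : AEStronglyMeasurable (fun t => (μ - t) * f t) volume := by
    have := aestronglyMeasurable_union_iff.2 ⟨a1, a2⟩
    rwa [Set.union_compl_self, Measure.restrict_univ] at this
  have a4 : AEMeasurable (fun t => (μ - t)⁻¹ * ((μ - t) * f t)) volume :=
    (by fun_prop : Measurable fun t : ℝ => (μ - t)⁻¹).aemeasurable.mul a3.aemeasurable
  refine a4.congr ?_
  have : ∀ᵐ x : ℝ, x ≠ μ := by simp [ae_iff, measure_singleton]
  filter_upwards [this] with x hx
  rw [inv_mul_cancel_left₀ (sub_ne_zero.2 hx.symm)]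

lemma erealIoo_open (α ω : EReal) : IsOpen (erealIoo α ω) := by
  have : erealIoo α ω = (fun x : ℝ => (x:EReal)) ⁻¹' (Set.Ioo α ω) := rfl
  rw [this]
  exact isOpen_Ioo.preimage continuous_coe_real_ereal

lemma erealIoo_oc (α ω : EReal) : (erealIoo α ω).OrdConnected := by
  refine ⟨fun x hx y hy z hz => ⟨hx.1.trans_le ?_, lt_of_le_of_lt ?_ hy.2⟩⟩
  · exact_mod_cast hz.1
  · exact_mod_cast hz.2

section base
variable {P : Measure ℝ} {f : ℝ → ℝ} {μ : ℝ}

lemma P_int (hP : P = volume.withDensity (fun x => ENNReal.ofReal (f x))) (fm : AEMeasurable f)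
    (f0 : ∀ x, 0 ≤ f x) (hJ : {x : ℝ | 0 < f x} = J) (h : ℝ → ℝ) :
    ∫ x, h x ∂P = ∫ x in J, h x * f x := by
  rw [hP, integral_withDensity_eq_integral_toReal_smul₀ fm.ennreal_ofReal (by simp),
    setIntegral_eq_integral_of_forall_compl_eq_zero]
  · congr 1; ext x
    rw [ENNReal.toReal_ofReal (f0 x), smul_eq_mul, mul_comm]
  · intro x hx
    rw [← hJ] at hx
    have : f x = 0 := le_antisymm (not_lt.1 hx) (f0 x)
    rw [this, mul_zero]

lemma P_integrable (hP : P = volume.withDensity (fun x => ENNReal.ofReal (f x))) (fm : AEMeasurable f)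
    (f0 : ∀ x, 0 ≤ f x) {h : ℝ → ℝ} (hi : Integrable h P) : Integrable (fun x => h x * f x) := by
  rw [hP, integrable_withDensity_iff_integrable_smul₀' fm.ennreal_ofReal (by simp)] at hi
  refine hi.congr ?_
  filter_upwards with x
  rw [ENNReal.toReal_ofReal (f0 x), smul_eq_mul, mul_comm]

lemma base (hδ : δ ≤ 0) (hIP : IsIntegratedPearson P f μ δ β γ) (op : IsOpen J) (oc : J.OrdConnected)
    (hJ : {x : ℝ | 0 < f x} = J) : PW J δ β γ f μ 1 := by
  obtain ⟨pr, f0, hP, ix, hμ, hq, hF⟩ := hIP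
  have fm := f_aem hq hF
  have mJ := oc.measurableSet
  have wp : ∀ x ∈ J, 0 < f x := fun x hx => by rw [← hJ] at hx; exact hx
  have wz : ∀ x, x ∉ J → f x = 0 := fun x hx => by
    rw [← hJ] at hx; exact le_antisymm (not_lt.1 hx) (f0 x)
  have i0 : Integrable f := by simpa using P_integrable hP fm f0 (integrable_const (μ := P) (1:ℝ))
  have i1 : Integrable (fun x => x * f x) := P_integrable hP fm f0 ix
  have t0 : ∫ x in J, f x = 1 := by
    have := P_int hP fm f0 hJ (fun _ => 1)
    simpa using this.symm
  have t1 : ∫ x in J, x * f x = μ := by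
    rw [hμ]; exact (P_int hP fm f0 hJ (fun x => x)).symm
  have ne : J.Nonempty := by
    rw [Set.nonempty_iff_ne_empty]; rintro rfl; simp at t0
  have il : Integrable (fun x => (1 * x - μ) * f x) := by
    refine (i1.sub (i0.const_mul μ)).congr ?_
    filter_upwards with x; simp; ring
  have tot : ∫ x in J, (1 * x - μ) * f x = 0 := by
    have e : ∀ x, (1 * x - μ) * f x = x * f x - μ * f x := by intro x; ring
    simp_rw [e]
    rw [integral_sub i1.integrableOn (i0.const_mul μ).integrableOn, integral_const_mul, t0, t1]; ring
  have hz : μ / 1 ∈ J := zero_mem op oc ne one_pos wp il.integrableOn tot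
  have eF : ∀ t, pq δ β γ t * f t = -∫ x in J ∩ Set.Iio t, (1 * x - μ) * f x := by
    intro t
    rw [← hF t, ← integral_neg, integral_Iic_eq_integral_Iio]
    have : ∫ x in J ∩ Set.Iio t, -((1 * x - μ) * f x) = ∫ x in Set.Iio t, -((1 * x - μ) * f x) := by
      refine (setIntegral_eq_of_subset_of_forall_sdiff_eq_zero measurableSet_Iio Set.inter_subset_right ?_).symm
      rintro x ⟨hx1, hx2⟩
      rw [wz x fun h => hx2 ⟨h, hx1⟩]; simp
    rw [this]
    congr 1; ext x; ring
  have tail : ∀ t ∈ J, ∫ x in J ∩ Set.Ici t, (1 * x - μ) * f x = pq δ β γ t * f t := by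
    intro t _
    rw [tail_split il.integrableOn mJ, tot, eF t]; ring
  have hqf : ∀ t ∈ J, 0 < pq δ β γ t * f t := by
    intro t ht
    obtain ⟨a, b, hab, hs⟩ := mem_nhds_iff_exists_Ioo_subset.1 (op.mem_nhds ht)
    rcases le_or_gt t μ with h | h
    · rw [eF t, ← integral_neg]
      refine pos_int (U := J ∩ Set.Iio t) (mJ.inter measurableSet_Iio) (op.inter isOpen_Iio) ?_ subset_rfl ?_ ?_
        il.neg.integrableOn
      · obtain ⟨c, hc⟩ := exists_between hab.1
        exact ⟨c, hs ⟨hc.1, hc.2.trans hab.2⟩, hc.2⟩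
      · intro x hx
        have h1 := wp x hx.1
        have h2 : x < t := hx.2
        have : 0 < (μ - x) * f x := mul_pos (by linarith) h1
        linarith
      · intro x hx
        have h1 := wp x hx.1
        have h2 : x < t := hx.2
        have : 0 < (μ - x) * f x := mul_pos (by linarith) h1
        linarith
    · rw [← tail t ht]
      refine pos_int (U := J ∩ Set.Ioi t) (mJ.inter measurableSet_Ici) (op.inter isOpen_Ioi) ?_
        (Set.inter_subset_inter_right _ Set.Ioi_subset_Ici_self) ?_ ?_ il.integrableOn
      · obtain ⟨c, hc⟩ := exists_between hab.2
        exact ⟨c, hs ⟨hab.1.trans hc.1, hc.2⟩, hc.1⟩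
      · intro x hx
        have h1 := wp x hx.1
        have h2 : t < x := hx.2
        exact mul_pos (by linarith) h1
      · intro x hx
        have h1 := wp x hx.1
        have h2 : t ≤ x := hx.2
        exact (mul_pos (by linarith) h1).le
  have qp : ∀ x ∈ J, 0 < pq δ β γ x := fun x hx => (pos_iff_pos_of_mul_pos (hqf x hx)).2 (wp x hx)
  have wc : ContinuousOn f J := by
    have h1 := (acp_tail oc il.integrableOn).cont op
    refine (h1.div pq_cont.continuousOn fun x hx => (qp x hx).ne').congr fun x hx => ?_
    simp only [Pi.div_apply]
    rw [tail x hx, mul_div_cancel_left₀ _ (qp x hx).ne']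
  exact ⟨op, oc, hδ, one_pos, hz, wc, wp, qp, i0.integrableOn, i1.integrableOn, tot, tail⟩
end base

lemma memH_acp {P : Measure ℝ} {q : ℝ → ℝ} {n : ℕ} {gd : ℕ → ℝ → ℝ} (op : IsOpen J) (oc : J.OrdConnected) (hn : 1 ≤ n)
    (hg : MemH P q J n n gd) : ∀ j < n, ACP J (gd j) (gd (j+1)) := by
  obtain ⟨h1, h2, h3, -, -⟩ := hg
  simp only [max_self] at h1 h2 h3
  intro j hj
  rcases (show j + 1 = n ∨ j + 1 < n by omega) with h | h
  · have := h3 hn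
    rw [← h, Nat.add_sub_cancel] at this
    exact this
  · refine acp_of_deriv oc (h1 j h) ?_
    rcases (show j + 1 + 1 = n ∨ j + 1 + 1 < n by omega) with h' | h'
    · have := h2 hn
      rwa [← h', Nat.add_sub_cancel] at this
    · exact fun x hx => (h1 (j+1) h' x hx).continuousAt.continuousWithinAt

lemma sum_Icc_shift (F : ℕ → ℝ) (k : ℕ) : ∑ i ∈ Finset.Icc 1 k, F i = ∑ j ∈ Finset.range k, F (j+1) := by
  induction k with
  | zero => simp
  | succ k ih => rw [Finset.sum_Icc_succ_top (by omega), ih, Finset.sum_range_succ]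

lemma fall_nat (N i : ℕ) (h : i ≤ N) : fall (N:ℝ) i = (N.descFactorial i : ℝ) := by
  induction i with
  | zero => simp [fall]
  | succ i ih =>
    have : fall (N:ℝ) (i+1) = fall (N:ℝ) i * (N - i) := by unfold fall; rw [Finset.prod_range_succ]
    rw [this, ih (by omega), Nat.descFactorial_succ]
    push_cast [show i ≤ N by omega]; ring

lemma choose_fall (n i : ℕ) (h : i ≤ n) :
    (n.choose i : ℝ) * ((i.factorial : ℝ) * (n+1)) = ((n:ℝ) + 1 - i) * fall ((n:ℝ) + (1:ℕ)) i := by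
  have e : (n:ℝ) + (1:ℕ) = ((n+1:ℕ):ℝ) := by push_cast; ring
  rw [e, fall_nat _ _ (by omega), Nat.descFactorial_eq_factorial_mul_choose]
  have := Nat.choose_mul_succ_eq n i
  have h2 : ((n.choose i * (n+1) : ℕ):ℝ) = (((n+1).choose i * (n+1-i):ℕ):ℝ) := by rw [this]
  push_cast [show i ≤ n + 1 by omega] at h2 ⊢
  linear_combination (i.factorial : ℝ) * h2

lemma fall_pos (n i : ℕ) (h : i ≤ n) : 0 < fall ((n:ℝ) + (1:ℕ)) i := by
  have e : (n:ℝ) + (1:ℕ) = ((n+1:ℕ):ℝ) := by push_cast; ring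
  rw [e, fall_nat _ _ (by omega)]
  have : 0 < (n+1).descFactorial i := Nat.pos_of_ne_zero (by
    rw [Ne, Nat.descFactorial_eq_zero_iff_lt]; omega)
  exact_mod_cast this

end

section
variable {J : Set ℝ} {δ β γ : ℝ} {w : ℝ → ℝ} {m s : ℝ}

lemma pp_one (a : ℝ) : pp δ a 1 = 1 - a * δ := by simp [pp]

/-- one term of the difference of the two first sums -/
lemma term_id {n j : ℕ} (hj : j < n) {I K D : ℝ} (hI : 0 < I) (hK : 0 < K) (hl : 0 < 1 - (n:ℝ) * δ) :
    (D ^ 2 / (((j+1).factorial : ℝ) * I * K)) -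
      ((n.choose (j+1) : ℝ) * (1 - ((n:ℝ) + ((j+1:ℕ):ℝ)) * δ) /
        (fall ((n:ℝ) + (1:ℕ)) (j+1) * I * K * (1 - (n:ℝ) * δ))) * D ^ 2 =
    (((j:ℝ)+1) * (1 - j * δ) * (D ^ 2 / (((j+1).factorial : ℝ) * K * I))) / (((n:ℝ)+1) * (1 - n * δ)) := by
  have h1 := choose_fall n (j+1) hj
  have h2 := fall_pos n (j+1) hj
  have h3 : (0:ℝ) < ((j+1).factorial : ℝ) := by exact_mod_cast Nat.factorial_pos _
  have h4 : (0:ℝ) < (n:ℝ) + 1 := by positivity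
  have hC : (n.choose (j+1) : ℝ) = ((n:ℝ) + 1 - ((j+1:ℕ):ℝ)) * fall ((n:ℝ) + (1:ℕ)) (j+1) / (((j+1).factorial : ℝ) * (n+1)) := by
    rw [eq_div_iff (by positivity)]; exact h1
  rw [hC]
  generalize fall ((n:ℝ) + (1:ℕ)) (j+1) = F at h2 ⊢
  generalize ((j+1).factorial : ℝ) = R at h3 ⊢
  push_cast
  generalize (n:ℝ) = N at *
  obtain ⟨L, hL⟩ : ∃ L, L = 1 - N * δ := ⟨_, rfl⟩
  rw [← hL] at hl ⊢
  field_simp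
  rw [hL]
  ring

lemma poly_deriv (op : IsOpen J) {u u' : ℝ → ℝ} {d : ℕ} (hd : ∀ x ∈ J, HasDerivAt u (u' x) x)
    (h : IsPolyOn u J (d+1)) : IsPolyOn u' J d := by
  obtain ⟨p, hp, he⟩ := h
  refine ⟨p.derivative, (Polynomial.natDegree_derivative_le p).trans (by omega), fun x hx => ?_⟩
  have h1 : HasDerivAt u (p.derivative.eval x) x :=
    (p.hasDerivAt x).congr_of_eventuallyEq (by
      filter_upwards [op.mem_nhds hx] with y hy using he y hy)
  exact (hd x hx).unique h1
end


/-- **Theorem 3.2(a).** If `X ∼ IP(μ; δ, β, γ)` with `δ ≤ 0`, `n ≥ 1` and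
`g ∈ H^{n,n}(X)`, then `S_{n,1}(g) ≤ S_{n,(str)}`, with equality iff `n = 1` or
`g` coincides on the support of `X` with a polynomial of degree at most `n+1`. -/
theorem pearson_Sn1_le_Sstr
    (P : Measure ℝ) (f : ℝ → ℝ) (μ δ β γ : ℝ) (hδ : δ ≤ 0)
    (hIP : IsIntegratedPearson P f μ δ β γ)
    (α ω : EReal) (hsupp : {x : ℝ | 0 < f x} = erealIoo α ω)
    (n : ℕ) (hn : 1 ≤ n) (gd : ℕ → ℝ → ℝ)
    (hg : MemH P (pq δ β γ) (erealIoo α ω) n n gd) :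
    Sbound P δ (pq δ β γ) n 1 gd ≤ SstrBound P δ (pq δ β γ) n gd ∧
    (Sbound P δ (pq δ β γ) n 1 gd = SstrBound P δ (pq δ β γ) n gd ↔
      n = 1 ∨ IsPolyOn (gd 0) (erealIoo α ω) (n + 1)) := by
  obtain ⟨k, rfl⟩ : ∃ k, n = k + 1 := ⟨n - 1, by omega⟩
  have op := erealIoo_open α ω
  have oc := erealIoo_oc α ω
  generalize erealIoo α ω = J at hsupp hg op oc ⊢
  have H : PW J δ β γ f μ 1 := base hδ hIP op oc hsupp
  have hA := memH_acp op oc hn hg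
  obtain ⟨pr, f0, hP, ix, hμ, hq, hF⟩ := hIP
  have fm := f_aem hq hF
  have PI := P_int hP fm f0 hsupp
  have hm : ∀ j ≤ k, AEStronglyMeasurable (gd (j+1)) (volume.restrict J) :=
    fun j hj => (hA j (by omega)).aesm op
  have hi : IntegrableOn (fun t => gd (k+1) t ^ 2 * (pq δ β γ t ^ (k+1) * f t)) J := by
    refine ((P_integrable hP fm f0 hg.2.2.2.1).congr ?_).integrableOn
    filter_upwards with x; ring
  set D : ℕ → ℝ := fun j => ∫ x, pq δ β γ x ^ (j+1) * gd (j+1) x ∂P with hD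
  have hD' : ∀ j, D j = ∫ x in J, gd (j+1) x * (pq δ β γ x ^ (j+1) * f x) := by
    intro j; simp only [hD]; rw [PI]; congr 1; ext x; ring
  have hII : ∀ j, ∫ x, pq δ β γ x ^ j ∂P = II J δ β γ f j := by
    intro j; rw [PI]; rfl
  have hSq : ∀ j, ∫ x, pq δ β γ x ^ j * gd j x ^ 2 ∂P = ∫ x in J, gd j x ^ 2 * (pq δ β γ x ^ j * f x) := by
    intro j; rw [PI]; congr 1; ext x; ring
  set A : ℝ := ∫ x, pq δ β γ x ^ 1 * gd 1 x ^ 2 ∂P with hAA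
  set B : ℝ := (∫ x, pq δ β γ x ^ (k+1) * gd (k+1) x ^ 2 ∂P) - D k ^ 2 / II J δ β γ f (k+1) with hB
  set T : ℝ := ∑ j ∈ Finset.range (k+1), ((j:ℝ)+1) * (1 - j * δ) *
          (D j ^ 2 / (((j+1).factorial : ℝ) * kap δ 1 (j+1) * II J δ β γ f (j+1))) with hT
  have M := main_abs H (k := k) (G := fun j => gd (j+1)) (fun j hj => hA (j+1) (by omega)) hm hi hD'
    hT (A := A) (by rw [hAA, hSq]; simp) (B := B) (by rw [hB, hSq]) rfl
  have cp := H.next.cc_pos k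
  have csucc : cc δ 1 (k+1) = _ := cc_succ (δ := δ) (s := 1) (k := k)
  generalize cc δ (1 - 2 * δ) k = c at M cp csucc
  obtain ⟨M1, M2, M3⟩ := M
  have lp : 0 < 1 - ((k+1:ℕ):ℝ) * δ := H.sd (k+1)
  set l : ℝ := (((k+1:ℕ):ℝ) + 1) * (1 - ((k+1:ℕ):ℝ) * δ) with hl
  have lpos : 0 < l := by rw [hl]; positivity
  have key : SstrBound P δ (pq δ β γ) (k+1) gd - Sbound P δ (pq δ β γ) (k+1) 1 gd = (B / c - (A - T)) / l := by
    unfold SstrBound Sbound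
    have e1 : (((k+1+1).factorial : ℝ) * pp δ ((k+1:ℕ):ℝ) (k+1)) = l * c := by
      rw [← csucc]; rfl
    have e2 : ∑ i ∈ Finset.Icc 1 1, (-1 : ℝ) ^ (i - 1) *
          (((1:ℕ).choose i : ℝ) / (fall (((k+1:ℕ) : ℝ) + (1:ℕ)) i * pp δ ((k+1:ℕ) : ℝ) i)) *
        ∫ x, pq δ β γ x ^ i * (gd i x) ^ 2 ∂P = A / l := by
      have e5 : fall (((k+1:ℕ) : ℝ) + (1:ℕ)) 1 = ((k+1:ℕ):ℝ) + 1 := by simp [fall]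
      rw [Finset.Icc_self, Finset.sum_singleton, pp_one, ← hAA, e5, ← hl]
      simp only [Nat.choose_self, Nat.cast_one, Nat.sub_self, pow_zero, one_mul]
      rw [one_div, mul_comm, div_eq_mul_inv]
    have e3 : T / l = (∑ i ∈ Finset.Icc 1 (k+1), (∫ x, pq δ β γ x ^ i * gd i x ∂P) ^ 2 /
        ((i.factorial : ℝ) * (∫ x, pq δ β γ x ^ i ∂P) * pp δ ((i : ℝ) - 1) i)) -
        ∑ i ∈ Finset.Icc 1 (k+1),
      (((k+1).choose i : ℝ) * pp δ (((k+1:ℕ) : ℝ) + i) 1 /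
          (fall (((k+1:ℕ) : ℝ) + (1:ℕ)) i * (∫ x, pq δ β γ x ^ i ∂P) * pp δ ((i : ℝ) - 1) i *
            pp δ ((k+1:ℕ) : ℝ) 1)) *
        (∫ x, pq δ β γ x ^ i * gd i x ∂P) ^ 2 := by
      rw [sum_Icc_shift, sum_Icc_shift, ← Finset.sum_sub_distrib, hT, Finset.sum_div]
      refine Finset.sum_congr rfl fun j hj => ?_
      rw [pp_one, pp_one, hII]
      exact (term_id (Finset.mem_range.1 hj) (H.I_pos (j+1)) (H.kap_pos (j+1)) lp).symm
    rw [e1, e2, hII (k+1)]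
    have e4 : (B / c - (A - T)) / l = B / (l * c) - A / l + T / l := by
      field_simp
      ring
    rw [e4, e3, hB]
    ring
  have eqv : Sbound P δ (pq δ β γ) (k+1) 1 gd = SstrBound P δ (pq δ β γ) (k+1) gd ↔ c * (A - T) = B := by
    rw [eq_comm, ← sub_eq_zero, key, div_eq_zero_iff, or_iff_left lpos.ne', sub_eq_zero, div_eq_iff cp.ne',
      eq_comm, mul_comm]
  refine ⟨?_, ?_⟩
  · rw [← sub_nonneg, key]
    refine div_nonneg (sub_nonneg.2 ?_) lpos.le
    rw [le_div_iff₀ cp, mul_comm]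
    exact M1
  · rw [eqv]
    rcases Nat.eq_zero_or_pos k with rfl | hk
    · exact ⟨fun _ => Or.inl rfl, fun _ => M3 (Or.inl rfl)⟩
    · have hd : ∀ x ∈ J, HasDerivAt (gd 0) (gd 1 x) x := hg.1 0 (by rw [max_self]; omega)
      constructor
      · intro h
        obtain ⟨p, pd, pe⟩ := M2 hk h
        obtain ⟨R, -, hR, hRe⟩ := acp_poly_of_ae oc (hA 0 (by omega)) pd (by
          filter_upwards [ae_restrict_mem oc.measurableSet] with x hx using pe x hx)
        exact Or.inr ⟨R, hR, hRe⟩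
      · rintro (h | h)
        · omega
        · exact M3 (Or.inr (poly_deriv op hd h))

end
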